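/- arXiv:0908.3293 — 5 statements merged into one kernel-verified Lean document; each statement's English description precedes it below -/
import Mathlib

section
/- Let n ≥ 1, let 0 < τ₁ < τ₂, and let A : ℝ → Matrix (Fin n) (Fin n) ℝ be twice continuously differentiable on [τ₁,τ₂] with A(τ) invertible for every τ ∈ [τ₁,τ₂], and suppose A satisfies the second-order linear ODE A''(τ) + (1/(2τ))·A'(τ) = M(τ)·A(τ) on [τ₁,τ₂], where M : ℝ → Matrix (Fin n) (Fin n) ℝ is continuous. Define α(τ) := -(1/2)·log(det(A(τ)ᵀ·A(τ))) and B(τ) := A'(τ)·A(τ)⁻¹. Then for every τ ∈ [τ₁,τ₂]: τ^(-1/2) · d/dτ(√τ · α'(τ)) = trace(B(τ)²) - trace(M(τ)). -/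
open Matrix Set

theorem Matrix.hasDerivWithinAt_det {n : Type*} [Fintype n] [DecidableEq n]
    {A : ℝ → Matrix n n ℝ} {A' : Matrix n n ℝ} {s : Set ℝ} {t : ℝ}
    (h : ∀ i j, HasDerivWithinAt (fun u => A u i j) (A' i j) s t) :
    HasDerivWithinAt (fun u => (A u).det) (((A t).adjugate * A').trace) s t := by
  simp_rw [Matrix.det_apply']
  refine (HasDerivWithinAt.fun_sum fun σ _ =>
    (HasDerivWithinAt.fun_finsetProd fun i _ => h (σ i) i).const_mul _).congr_deriv ?_
  have key (j : n) : ((A t).adjugate * A') j j = ((A t).updateCol j (fun i => A' i j)).det := by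
    rw [← cramer_apply, cramer_eq_adjugate_mulVec]
    rfl
  simp_rw [Matrix.trace, Matrix.diag, key, Matrix.det_apply', Finset.mul_sum]
  rw [Finset.sum_comm]
  refine Finset.sum_congr rfl fun j _ => Finset.sum_congr rfl fun σ _ => ?_
  rw [← Finset.mul_prod_erase _ _ (Finset.mem_univ j)]
  simp only [updateCol_self, smul_eq_mul]
  rw [mul_comm (A' _ _)]
  congr 2
  refine Finset.prod_congr rfl fun i hi => ?_
  rw [updateCol_ne (Finset.ne_of_mem_erase hi)]

section
attribute [local instance] Matrix.linftyOpNormedRing Matrix.linftyOpNormedAlgebra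

theorem Matrix.hasDerivWithinAt_inv_apply {n : Type*} [Fintype n] [DecidableEq n]
    {A : ℝ → Matrix n n ℝ} {A' : Matrix n n ℝ} {s : Set ℝ} {t : ℝ} (hA : IsUnit (A t))
    (h : ∀ i j, HasDerivWithinAt (fun u => A u i j) (A' i j) s t) (i j : n) :
    HasDerivWithinAt (fun u => (A u)⁻¹ i j) ((-((A t)⁻¹ * A' * (A t)⁻¹)) i j) s t := by
  have hd : HasDerivWithinAt A A' s t :=
    hasDerivWithinAt_pi.2 fun i => hasDerivWithinAt_pi.2 fun j => h i j
  obtain ⟨x, hx⟩ := hA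
  have hr := hasFDerivAt_ringInverse (𝕜 := ℝ) x
  rw [hx] at hr
  have hc := hr.comp_hasDerivWithinAt t hd
  have he := hasDerivWithinAt_pi.1 (hasDerivWithinAt_pi.1 hc i) j
  simpa [Function.comp_def, ← Matrix.nonsing_inv_eq_ringInverse, ← hx] using he
end

theorem Matrix.hasDerivWithinAt_log_det_transpose_mul_self {n : Type*} [Fintype n] [DecidableEq n]
    {A : ℝ → Matrix n n ℝ} {A' : Matrix n n ℝ} {s : Set ℝ} {t : ℝ} (hA : IsUnit (A t))
    (h : ∀ i j, HasDerivWithinAt (fun u => A u i j) (A' i j) s t) :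
    HasDerivWithinAt (fun u => Real.log ((A u)ᵀ * A u).det) (2 * (A' * (A t)⁻¹).trace) s t := by
  have hdet : (A t).det ≠ 0 := ((isUnit_iff_isUnit_det _).1 hA).ne_zero
  simp only [det_mul, det_transpose]
  have hd := hasDerivWithinAt_det h
  refine ((hd.fun_mul hd).log (mul_ne_zero hdet hdet)).congr_deriv ?_
  rw [inv_def, Ring.inverse_eq_inv', mul_smul_comm, trace_smul, trace_mul_comm A', smul_eq_mul]
  field_simp
  ring

theorem Matrix.hasDerivWithinAt_trace_mul {m n : Type*} [Fintype m] [Fintype n]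
    {A : ℝ → Matrix m n ℝ} {B : ℝ → Matrix n m ℝ} {A' : Matrix m n ℝ} {B' : Matrix n m ℝ}
    {s : Set ℝ} {t : ℝ}
    (hA : ∀ i j, HasDerivWithinAt (fun u => A u i j) (A' i j) s t)
    (hB : ∀ i j, HasDerivWithinAt (fun u => B u i j) (B' i j) s t) :
    HasDerivWithinAt (fun u => (A u * B u).trace) ((A' * B t).trace + (A t * B').trace) s t := by
  simp only [Matrix.trace, diag, mul_apply, ← Finset.sum_add_distrib]
  exact HasDerivWithinAt.fun_sum fun i _ => HasDerivWithinAt.fun_sum fun j _ =>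
    (hA i j).fun_mul (hB j i)

theorem matrix_ode_log_det_identity
    (n : ℕ) (hn : 1 ≤ n) (τ₁ τ₂ : ℝ) (hτ₁ : 0 < τ₁) (hτ₁₂ : τ₁ < τ₂)
    (A A' A'' M : ℝ → Matrix (Fin n) (Fin n) ℝ)
    -- A is twice continuously differentiable on [τ₁,τ₂], with entrywise
    -- first derivative A' and second derivative A''
    (hA' : ∀ τ ∈ Icc τ₁ τ₂, ∀ i j,
      HasDerivWithinAt (fun t => A t i j) (A' τ i j) (Icc τ₁ τ₂) τ)
    (hA'' : ∀ τ ∈ Icc τ₁ τ₂, ∀ i j,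
      HasDerivWithinAt (fun t => A' t i j) (A'' τ i j) (Icc τ₁ τ₂) τ)
    (hA''cont : ∀ i j, ContinuousOn (fun t => A'' t i j) (Icc τ₁ τ₂))
    -- A(τ) is invertible on [τ₁,τ₂]
    (hinv : ∀ τ ∈ Icc τ₁ τ₂, IsUnit (A τ))
    -- M is continuous
    (hM : ∀ i j, ContinuousOn (fun t => M t i j) (Icc τ₁ τ₂))
    -- the second-order linear ODE  A'' + (1/(2τ))·A' = M·A
    (hODE : ∀ τ ∈ Icc τ₁ τ₂, A'' τ + (1 / (2 * τ)) • A' τ = M τ * A τ)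
    -- α(τ) := -(1/2)·log det(Aᵀ A)  and  B(τ) := A'·A⁻¹
    (α : ℝ → ℝ) (hα : ∀ τ, α τ = -(1 / 2) * Real.log ((A τ)ᵀ * A τ).det)
    (B : ℝ → Matrix (Fin n) (Fin n) ℝ) (hB : ∀ τ, B τ = A' τ * (A τ)⁻¹) :
    ∀ τ ∈ Icc τ₁ τ₂,
      τ ^ (-(1 : ℝ) / 2) *
          derivWithin (fun t => Real.sqrt t * derivWithin α (Icc τ₁ τ₂) t) (Icc τ₁ τ₂) τ
        = (B τ ^ 2).trace - (M τ).trace := by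
  intro τ hτ
  have hpos : 0 < τ := hτ₁.trans_le hτ.1
  have hud : UniqueDiffOn ℝ (Icc τ₁ τ₂) := uniqueDiffOn_Icc hτ₁₂
  have hαd : ∀ t ∈ Icc τ₁ τ₂, derivWithin α (Icc τ₁ τ₂) t = -(A' t * (A t)⁻¹).trace := by
    intro t ht
    rw [funext hα]
    refine (((hasDerivWithinAt_log_det_transpose_mul_self (hinv t ht) (hA' t ht)).const_mul
      (-(1 / 2))).congr_deriv ?_).derivWithin (hud t ht)
    ring
  have htr := hasDerivWithinAt_trace_mul (hA'' τ hτ)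
    (hasDerivWithinAt_inv_apply (hinv τ hτ) (hA' τ hτ))
  have hD := (Real.hasDerivAt_sqrt hpos.ne').hasDerivWithinAt.fun_mul htr.fun_neg
  rw [derivWithin_congr (fun t ht => by rw [hαd t ht]) (by rw [hαd τ hτ]),
    hD.derivWithin (hud τ hτ)]
  have hdet : IsUnit (A τ).det := (isUnit_iff_isUnit_det _).1 (hinv τ hτ)
  have hA''B : (A'' τ * (A τ)⁻¹).trace = (M τ).trace - 1 / (2 * τ) * (B τ).trace := by
    rw [eq_sub_of_add_eq (hODE τ hτ), sub_mul, mul_nonsing_inv_cancel_right _ _ hdet, trace_sub,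
      smul_mul_assoc, trace_smul, smul_eq_mul, hB]
  have hBB : (A' τ * -((A τ)⁻¹ * A' τ * (A τ)⁻¹)).trace = -(B τ ^ 2).trace := by
    rw [hB, sq, mul_neg, trace_neg]
    simp only [Matrix.mul_assoc]
  rw [hA''B, hBB, ← hB, neg_div, Real.rpow_neg hpos.le, ← Real.sqrt_eq_rpow]
  have hs : 0 < √τ := Real.sqrt_pos.2 hpos
  have hsq : √τ ^ 2 = τ := Real.sq_sqrt hpos.le
  generalize √τ = r at hs hsq
  subst hsq
  field_simp
  ring
end

section
/- Let n ≥ 1, let 0 < τ₁ < τ₂, and let f : ℝ → ℝ be twice continuously differentiable on [τ₁,τ₂]. If d/dτ(τ^(3/2) · f'(τ)) ≥ -(n/4)·τ^(-1/2) for all τ ∈ [τ₁,τ₂], then the function s ↦ f(1/s²) + (n/2)·log(1/s²) is convex on the interval [1/√τ₂, 1/√τ₁]. -/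
open Set

/-- The map `s ↦ 1 / s ^ 2` sends `[1 / √b, 1 / √a]` into `[a, b]`. -/
lemma one_div_sq_mem_Icc {a b s : ℝ} (ha : 0 < a) (hb : 0 < b)
    (hs : s ∈ Icc (1 / Real.sqrt b) (1 / Real.sqrt a)) : 1 / s ^ 2 ∈ Icc a b := by
  have hsb : 0 < 1 / Real.sqrt b := by positivity
  have h₁ := pow_le_pow_left₀ hsb.le hs.1 2
  have h₂ := pow_le_pow_left₀ (hsb.le.trans hs.1) hs.2 2
  have hs2 : 0 < s ^ 2 := pow_pos (hsb.trans_le hs.1) 2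
  rw [div_pow, one_pow, Real.sq_sqrt hb.le] at h₁
  rw [div_pow, one_pow, Real.sq_sqrt ha.le] at h₂
  exact ⟨(le_one_div ha hs2).2 h₂, (one_div_le hs2 hb).2 h₁⟩

/-- The map `s ↦ 1 / s ^ 2` sends `(1 / √b, 1 / √a)` into `(a, b)`. -/
lemma one_div_sq_mem_Ioo {a b s : ℝ} (ha : 0 < a) (hb : 0 < b)
    (hs : s ∈ Ioo (1 / Real.sqrt b) (1 / Real.sqrt a)) : 1 / s ^ 2 ∈ Ioo a b := by
  have hsb : 0 < 1 / Real.sqrt b := by positivity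
  have h₁ := pow_lt_pow_left₀ hs.1 hsb.le two_ne_zero
  have h₂ := pow_lt_pow_left₀ hs.2 (hsb.trans hs.1).le two_ne_zero
  have hs2 : 0 < s ^ 2 := pow_pos (hsb.trans hs.1) 2
  rw [div_pow, one_pow, Real.sq_sqrt hb.le] at h₁
  rw [div_pow, one_pow, Real.sq_sqrt ha.le] at h₂
  exact ⟨(lt_one_div ha hs2).2 h₂, (one_div_lt hs2 hb).2 h₁⟩

lemma hasDerivAt_one_div_sq {s : ℝ} (hs : s ≠ 0) :
    HasDerivAt (fun s : ℝ => 1 / s ^ 2) (-2 / s ^ 3) s := by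
  refine ((hasDerivAt_const s (1 : ℝ)).fun_div (hasDerivAt_pow 2 s)
    (pow_ne_zero 2 hs)).congr_deriv ?_
  field_simp
  ring

lemma one_div_sq_rpow {s : ℝ} (hs : 0 < s) (p : ℝ) : (1 / s ^ 2) ^ p = s ^ (-2 * p) := by
  rw [Real.rpow_mul hs.le, Real.rpow_neg hs.le, one_div, Real.rpow_two]

theorem convex_in_inverse_sqrt_tau
    (n : ℕ) (hn : 1 ≤ n) (τ₁ τ₂ : ℝ) (hτ₁ : 0 < τ₁) (hτ₁₂ : τ₁ < τ₂)
    (f f' f'' : ℝ → ℝ)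
    -- f is twice continuously differentiable on [τ₁,τ₂]
    (hf' : ∀ τ ∈ Icc τ₁ τ₂, HasDerivWithinAt f (f' τ) (Icc τ₁ τ₂) τ)
    (hf'' : ∀ τ ∈ Icc τ₁ τ₂, HasDerivWithinAt f' (f'' τ) (Icc τ₁ τ₂) τ)
    (hf''cont : ContinuousOn f'' (Icc τ₁ τ₂))
    -- d/dτ (τ^(3/2) · f'(τ)) ≥ -(n/4)·τ^(-1/2) on [τ₁,τ₂]
    (hmono : ∀ τ ∈ Icc τ₁ τ₂,
      derivWithin (fun t => t ^ ((3 : ℝ) / 2) * f' t) (Icc τ₁ τ₂) τ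
        ≥ -((n : ℝ) / 4) * τ ^ (-(1 : ℝ) / 2)) :
    ConvexOn ℝ (Icc (1 / Real.sqrt τ₂) (1 / Real.sqrt τ₁))
      (fun s => f (1 / s ^ 2) + ((n : ℝ) / 2) * Real.log (1 / s ^ 2)) := by
  have hτ₂ : 0 < τ₂ := hτ₁.trans hτ₁₂
  have hpos : ∀ s, 1 / Real.sqrt τ₂ ≤ s → 0 < s := fun s hs =>
    lt_of_lt_of_le (by positivity) hs
  refine convexOn_of_hasDerivWithinAt2_nonneg (convex_Icc _ _)
    (f' := fun s => f' (1 / s ^ 2) * (-2 / s ^ 3) - n / s)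
    (f'' := fun s => f'' (1 / s ^ 2) * (-2 / s ^ 3) * (-2 / s ^ 3)
      + f' (1 / s ^ 2) * (6 / s ^ 4) + n / s ^ 2) ?_ ?_ ?_ ?_
  · have hsq : ContinuousOn (fun s : ℝ => 1 / s ^ 2)
        (Icc (1 / Real.sqrt τ₂) (1 / Real.sqrt τ₁)) := fun s hs =>
      (hasDerivAt_one_div_sq (hpos s hs.1).ne').continuousAt.continuousWithinAt
    have hfc : ContinuousOn f (Icc τ₁ τ₂) := fun τ hτ => (hf' τ hτ).continuousWithinAt
    refine (hfc.comp hsq fun s hs => one_div_sq_mem_Icc hτ₁ hτ₂ hs).add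
      (continuousOn_const.mul (hsq.log fun s hs => ?_))
    have := hpos s hs.1
    positivity
  all_goals
    rw [interior_Icc]
    intro s hs
    have hs0 : 0 < s := hpos s hs.1.le
    have hτ := one_div_sq_mem_Ioo hτ₁ hτ₂ hs
    have hτ' := Ioo_subset_Icc_self hτ
    have hsq := hasDerivAt_one_div_sq hs0.ne'
  · refine HasDerivAt.hasDerivWithinAt ?_
    have hf := (hf' _ hτ').hasDerivAt (Icc_mem_nhds hτ.1 hτ.2)
    refine ((hf.comp s hsq).add ((hsq.log (by positivity)).const_mul ((n : ℝ) / 2))).congr_deriv ?_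
    field_simp
    ring
  · refine HasDerivAt.hasDerivWithinAt ?_
    have hf := (hf'' _ hτ').hasDerivAt (Icc_mem_nhds hτ.1 hτ.2)
    have hcube : HasDerivAt (fun s : ℝ => -2 / s ^ 3) (6 / s ^ 4) s := by
      refine ((hasDerivAt_const s (-2 : ℝ)).fun_div (hasDerivAt_pow 3 s)
        (pow_ne_zero 3 hs0.ne')).congr_deriv ?_
      field_simp
      ring
    have hinv : HasDerivAt (fun s : ℝ => (n : ℝ) / s) (-n / s ^ 2) s := by
      refine ((hasDerivAt_const s (n : ℝ)).fun_div (hasDerivAt_id' s) hs0.ne').congr_deriv ?_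
      field_simp
      ring
    refine (((hf.comp s hsq).mul hcube).sub hinv).congr_deriv ?_
    simp only [Function.comp_apply]
    ring
  · have hd := ((Real.hasDerivAt_rpow_const (p := (3 : ℝ) / 2)
      (Or.inl (hτ₁.trans hτ.1).ne')).hasDerivWithinAt (s := Icc τ₁ τ₂)).fun_mul (hf'' _ hτ')
    have h := hmono _ hτ'
    rw [hd.derivWithin (uniqueDiffOn_Icc hτ₁₂ _ hτ'), one_div_sq_rpow hs0,
      one_div_sq_rpow hs0, one_div_sq_rpow hs0,
      show (-2 * (3 / 2 - 1) : ℝ) = -(1 : ℕ) by norm_num,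
      show (-2 * (3 / 2) : ℝ) = -(3 : ℕ) by norm_num,
      show (-2 * (-1 / 2) : ℝ) = 1 by norm_num, Real.rpow_neg hs0.le, Real.rpow_neg hs0.le,
      Real.rpow_natCast, Real.rpow_natCast, Real.rpow_one, pow_one] at h
    have h4 := mul_nonneg (by positivity : (0 : ℝ) ≤ 4 / s ^ 3) (sub_nonneg.2 h)
    refine h4.trans_eq ?_
    field_simp
    ring
end

section
/- Let n ≥ 1, let 0 < τ₁ < τ̄ < τ₂, and let λ ∈ (0,1) be determined by 1/√τ̄ = (1-λ)/√τ₁ + λ/√τ₂. Let u₁, u₂, v : ℝⁿ → ℝ be nonnegative Lebesgue-measurable functions such that for all x, y ∈ ℝⁿ, setting z := x + ((√τ̄ - √τ₁)/(√τ₂ - √τ₁))·(y - x), one has (τ̄/(τ₁^(1-λ)·τ₂^λ))^(n/2) · v(z) ≥ exp(-((1-λ)/(2√τ₁)) · ‖x - z‖²/(2(√τ̄ - √τ₁))) · u₁(x)^(1-λ) · exp((λ/(2√τ₂)) · ‖z - y‖²/(2(√τ₂ - √τ̄))) · u₂(y)^λ. Then ∫_{ℝⁿ} v dx ≥ (∫_{ℝⁿ}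 u₁ dx)^(1-λ) · (∫_{ℝⁿ} u₂ dx)^λ, all integrals with respect to Lebesgue measure. -/
open Set MeasureTheory

open scoped ENNReal Pointwise

/-- One-dimensional Brunn–Minkowski inequality for nonempty compact sets. -/
lemma IsCompact.volume_add_le_volume_add {K L : Set ℝ} (hK : IsCompact K) (hL : IsCompact L)
    (hK0 : K.Nonempty) (hL0 : L.Nonempty) :
    volume K + volume L ≤ volume (K + L) := by
  obtain ⟨a, haK, ha⟩ := hK.exists_isGreatest hK0
  obtain ⟨b, hbL, hb⟩ := hL.exists_isLeast hL0
  have hsub : (fun x => x + b) '' K ∪ (fun x => a + x) '' L ⊆ K + L := by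
    rintro _ (⟨x, hx, rfl⟩ | ⟨x, hx, rfl⟩)
    · exact add_mem_add hx hbL
    · exact add_mem_add haK hx
  have hinter : volume ((fun x => x + b) '' K ∩ (fun x => a + x) '' L) = 0 := by
    refine measure_mono_null (t := {a + b}) ?_ (by simp)
    rintro _ ⟨⟨x, hx, rfl⟩, ⟨y, hy, hxy⟩⟩
    have h1 := ha hx
    have h2 := hb hy
    simp only at hxy
    simp only [mem_singleton_iff]
    linarith
  have hm : MeasurableSet ((fun x => a + x) '' L) :=
    (hL.image (by fun_prop)).measurableSet
  calc volume K + volume L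
      = volume ((fun x => x + b) '' K) + volume ((fun x => a + x) '' L) := by
        simp [image_add_right, image_add_left, measure_preimage_add, measure_preimage_add_right]
    _ = volume ((fun x => x + b) '' K ∪ (fun x => a + x) '' L) := by
        rw [← measure_union_add_inter _ hm, hinter, add_zero]
    _ ≤ _ := measure_mono hsub

/-- One-dimensional Brunn–Minkowski inequality for nonempty measurable sets. -/
lemma MeasurableSet.volume_add_le_volume_add {A B : Set ℝ} (hA : MeasurableSet A)
    (hB : MeasurableSet B) (hA0 : A.Nonempty) (hB0 : B.Nonempty) :
    volume A + volume B ≤ volume (A + B) := by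
  obtain ⟨a, ha⟩ := hA0
  obtain ⟨b, hb⟩ := hB0
  refine le_of_forall_lt fun r hr => ?_
  obtain ⟨s, hs, t, ht, hrst⟩ : ∃ K, (K ⊆ A ∧ IsCompact K) ∧ ∃ L, (L ⊆ B ∧ IsCompact L) ∧
      r < volume K + volume L := by
    rw [hA.measure_eq_iSup_isCompact, hB.measure_eq_iSup_isCompact] at hr
    by_contra! h
    refine hr.not_ge ?_
    simp only [iSup_and'] at h ⊢
    refine ENNReal.biSup_add_biSup_le' ⟨∅, by simp⟩ ⟨∅, by simp⟩ ?_
    exact fun K hK L hL => h K hK L hL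
  have hK : IsCompact (insert a s) := hs.2.insert a
  have hL : IsCompact (insert b t) := ht.2.insert b
  calc r < volume s + volume t := hrst
    _ ≤ volume (insert a s) + volume (insert b t) := by gcongr <;> simp
    _ ≤ volume (insert a s + insert b t) :=
        hK.volume_add_le_volume_add hL (insert_nonempty _ _) (insert_nonempty _ _)
    _ ≤ volume (A + B) := by
        gcongr
        · exact insert_subset ha hs.1
        · exact insert_subset hb ht.1

/-- Layer-cake formula for a function bounded by `1`. -/
lemma lintegral_eq_setLIntegral_Ioo_meas_lt {α : Type*} [MeasurableSpace α] (μ : Measure α)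
    {f : α → ℝ≥0∞} (hf : Measurable f) (hf1 : ∀ x, f x ≤ 1) :
    ∫⁻ x, f x ∂μ = ∫⁻ t in Ioo (0 : ℝ) 1, μ {x | ENNReal.ofReal t < f x} := by
  have htop : ∀ x, f x ≠ ∞ := fun x => ((hf1 x).trans_lt ENNReal.one_lt_top).ne
  have h := lintegral_eq_lintegral_meas_lt (f := fun x => (f x).toReal) μ
    (.of_forall fun x => ENNReal.toReal_nonneg) hf.ennreal_toReal.aemeasurable
  simp only [ENNReal.ofReal_toReal (htop _)] at h
  rw [h, ← Ioi_inter_Iio, inter_comm, ← Measure.restrict_restrict measurableSet_Iio]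
  rw [← lintegral_indicator measurableSet_Iio]
  refine setLIntegral_congr_fun measurableSet_Ioi fun t (ht : 0 < t) => ?_
  have hset : {x | t < (f x).toReal} = {x | ENNReal.ofReal t < f x} := by
    ext x
    simp [ENNReal.ofReal_lt_iff_lt_toReal ht.le (htop x)]
  by_cases h1 : t < 1
  · simp [indicator, h1, hset]
  · have : {x | ENNReal.ofReal t < f x} = ∅ := by
      ext x
      simpa using (hf1 x).trans (by simpa using not_lt.1 h1)
    simp [h1, hset, this]

lemma ENNReal.rpow_mul_rpow_le_add {p q : ℝ} (hp : 0 < p) (hq : 0 < q) (hpq : p + q = 1)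
    (a b : ℝ≥0∞) : a ^ p * b ^ q ≤ ENNReal.ofReal p * a + ENNReal.ofReal q * b := by
  have hc : (p⁻¹).HolderConjugate q⁻¹ := by
    rw [Real.holderConjugate_iff]
    exact ⟨(one_lt_inv₀ hp).2 (by linarith), by simpa⟩
  have h := ENNReal.young_inequality (a ^ p) (b ^ q) hc
  rw [← ENNReal.rpow_mul, ← ENNReal.rpow_mul, mul_inv_cancel₀ hp.ne', mul_inv_cancel₀ hq.ne',
    ENNReal.rpow_one, ENNReal.rpow_one, ENNReal.ofReal_inv_of_pos hp,
    ENNReal.ofReal_inv_of_pos hq, div_eq_mul_inv, div_eq_mul_inv, inv_inv, inv_inv] at h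
  rwa [mul_comm a, mul_comm b] at h

/-- One-dimensional Prékopa–Leindler inequality, in the arithmetic form valid for functions
with supremum `1`. -/
lemma add_lintegral_le_lintegral_of_iSup_eq_one {p q : ℝ} (hp : 0 < p) (hq : 0 < q)
    (hpq : p + q = 1) {f g h : ℝ → ℝ≥0∞} (hf : Measurable f) (hg : Measurable g)
    (hh : Measurable h) (hf1 : ⨆ x, f x = 1) (hg1 : ⨆ x, g x = 1)
    (H : ∀ x y, f x ^ p * g y ^ q ≤ h (p * x + q * y)) :
    ENNReal.ofReal p * (∫⁻ x, f x) + ENNReal.ofReal q * (∫⁻ x, g x) ≤ ∫⁻ x, h x := by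
  have hmeas : ∀ φ : ℝ → ℝ≥0∞, Measurable fun t : ℝ => volume {x | ENNReal.ofReal t < φ x} :=
    fun φ => Antitone.measurable fun s t hst => measure_mono fun x hx =>
      (ENNReal.ofReal_le_ofReal hst).trans_lt hx
  calc ENNReal.ofReal p * (∫⁻ x, f x) + ENNReal.ofReal q * (∫⁻ x, g x)
      = ∫⁻ t in Ioo (0 : ℝ) 1, (ENNReal.ofReal p * volume {x | ENNReal.ofReal t < f x}
          + ENNReal.ofReal q * volume {x | ENNReal.ofReal t < g x}) := by
        rw [lintegral_add_left ((hmeas f).const_mul _), lintegral_const_mul _ (hmeas f),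
          lintegral_const_mul _ (hmeas g),
          lintegral_eq_setLIntegral_Ioo_meas_lt _ hf fun x => hf1 ▸ le_iSup f x,
          lintegral_eq_setLIntegral_Ioo_meas_lt _ hg fun x => hg1 ▸ le_iSup g x]
    _ ≤ ∫⁻ t in Ioo (0 : ℝ) 1, volume {x | ENNReal.ofReal t < min (h x) 1} := by
        refine setLIntegral_mono (hmeas _) fun t ht => ?_
        have ht1 : ENNReal.ofReal t < 1 := by simpa using ht.2
        obtain ⟨x₀, hx₀⟩ := lt_iSup_iff.1 (hf1 ▸ ht1)
        obtain ⟨y₀, hy₀⟩ := lt_iSup_iff.1 (hg1 ▸ ht1)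
        have hA : MeasurableSet {x | ENNReal.ofReal t < f x} := measurableSet_lt measurable_const hf
        have hB : MeasurableSet {x | ENNReal.ofReal t < g x} := measurableSet_lt measurable_const hg
        calc _ = volume (p • {x | ENNReal.ofReal t < f x})
                + volume (q • {x | ENNReal.ofReal t < g x}) := by
              simp [Measure.addHaar_smul, abs_of_pos hp, abs_of_pos hq]
          _ ≤ volume (p • {x | ENNReal.ofReal t < f x} + q • {x | ENNReal.ofReal t < g x}) :=
              (hA.const_smul_of_ne_zero hp.ne').volume_add_le_volume_add
                (hB.const_smul_of_ne_zero hq.ne') (Set.Nonempty.smul_set ⟨x₀, hx₀⟩)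
                (Set.Nonempty.smul_set ⟨y₀, hy₀⟩)
          _ ≤ _ := by
              refine measure_mono ?_
              rintro _ ⟨_, ⟨x, hx, rfl⟩, _, ⟨y, hy, rfl⟩, rfl⟩
              refine lt_min (lt_of_lt_of_le ?_ (H x y)) ht1
              calc ENNReal.ofReal t = ENNReal.ofReal t ^ p * ENNReal.ofReal t ^ q := by
                    rw [← ENNReal.rpow_add_of_nonneg _ _ hp.le hq.le, hpq, ENNReal.rpow_one]
                _ < _ := ENNReal.mul_lt_mul (ENNReal.rpow_lt_rpow hx hp)
                    (ENNReal.rpow_lt_rpow hy hq)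
    _ = ∫⁻ x, min (h x) 1 :=
        (lintegral_eq_setLIntegral_Ioo_meas_lt _ (hh.min measurable_const)
          fun x => min_le_right _ _).symm
    _ ≤ ∫⁻ x, h x := lintegral_mono fun x => min_le_left _ _

/-- One-dimensional Prékopa–Leindler inequality for bounded functions. -/
lemma prekopa_leindler_real_of_bounded {p q : ℝ} (hp : 0 < p) (hq : 0 < q)
    (hpq : p + q = 1) {f g h : ℝ → ℝ≥0∞} (hf : Measurable f) (hg : Measurable g)
    (hh : Measurable h) (hfb : ⨆ x, f x ≠ ∞) (hgb : ⨆ x, g x ≠ ∞)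
    (H : ∀ x y, f x ^ p * g y ^ q ≤ h (p * x + q * y)) :
    (∫⁻ x, f x) ^ p * (∫⁻ x, g x) ^ q ≤ ∫⁻ x, h x := by
  set M := ⨆ x, f x with hM
  set N := ⨆ x, g x with hN
  rcases eq_or_ne M 0 with hM0 | hM0
  · have : ∀ x, f x = 0 := by simpa [hM] using hM0
    simp [this, hp]
  rcases eq_or_ne N 0 with hN0 | hN0
  · have : ∀ x, g x = 0 := by simpa [hN] using hN0
    simp [this, hq]
  have hc0 : M ^ p * N ^ q ≠ 0 := by
    simp [hM0, hN0, hfb, hgb]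
  have hct : M ^ p * N ^ q ≠ ∞ := by
    finiteness
  have hmul : ∀ a b : ℝ≥0∞, (M⁻¹ * a) ^ p * (N⁻¹ * b) ^ q =
      (M ^ p * N ^ q)⁻¹ * (a ^ p * b ^ q) := by
    intro a b
    rw [ENNReal.mul_rpow_of_nonneg _ _ hp.le, ENNReal.mul_rpow_of_nonneg _ _ hq.le,
      ENNReal.inv_rpow, ENNReal.inv_rpow, ENNReal.mul_inv (by simp [hM0, hfb])
        (by simp [hN0, hgb])]
    ring
  have key := add_lintegral_le_lintegral_of_iSup_eq_one hp hq hpq (hf.const_mul M⁻¹)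
    (hg.const_mul N⁻¹) (hh.const_mul (M ^ p * N ^ q)⁻¹)
    (by rw [← ENNReal.mul_iSup, ← hM, ENNReal.inv_mul_cancel hM0 hfb])
    (by rw [← ENNReal.mul_iSup, ← hN, ENNReal.inv_mul_cancel hN0 hgb])
    (fun x y => by rw [hmul]; gcongr; exact H x y)
  have key2 := (ENNReal.rpow_mul_rpow_le_add hp hq hpq _ _).trans key
  rw [lintegral_const_mul _ hf, lintegral_const_mul _ hg, lintegral_const_mul _ hh, hmul] at key2
  exact (ENNReal.mul_le_mul_iff_right (ENNReal.inv_ne_zero.2 hct) (ENNReal.inv_ne_top.2 hc0)).1 key2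

lemma lintegral_eq_iSup_lintegral_min_natCast {α : Type*} [MeasurableSpace α] (μ : Measure α)
    {f : α → ℝ≥0∞} (hf : Measurable f) :
    ∫⁻ x, f x ∂μ = ⨆ n : ℕ, ∫⁻ x, min (f x) n ∂μ := by
  rw [← lintegral_iSup (fun n => hf.min measurable_const)
    (fun m n hmn x => min_le_min le_rfl (by exact_mod_cast hmn))]
  refine lintegral_congr fun x => ?_
  rw [← inf_iSup_eq, ENNReal.iSup_natCast, inf_top_eq]

/-- One-dimensional Prékopa–Leindler inequality. -/
lemma prekopa_leindler_real {p q : ℝ} (hp : 0 < p) (hq : 0 < q)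
    (hpq : p + q = 1) {f g h : ℝ → ℝ≥0∞} (hf : Measurable f) (hg : Measurable g)
    (hh : Measurable h) (H : ∀ x y, f x ^ p * g y ^ q ≤ h (p * x + q * y)) :
    (∫⁻ x, f x) ^ p * (∫⁻ x, g x) ^ q ≤ ∫⁻ x, h x := by
  rw [lintegral_eq_iSup_lintegral_min_natCast _ hf, lintegral_eq_iSup_lintegral_min_natCast _ hg]
  have hrpow : ∀ (s : ℝ) (_ : 0 < s) (F : ℕ → ℝ≥0∞), (⨆ n, F n) ^ s = ⨆ n, F n ^ s :=
    fun s hs F => (ENNReal.orderIsoRpow s hs).map_iSup F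
  rw [hrpow p hp, hrpow q hq]
  simp_rw [ENNReal.iSup_mul, ENNReal.mul_iSup]
  refine iSup₂_le fun m n => ?_
  have hb : ∀ (φ : ℝ → ℝ≥0∞) (k : ℕ), ⨆ x, min (φ x) k ≠ ∞ := fun φ k =>
    ((iSup_le fun x => min_le_right _ _).trans_lt (ENNReal.natCast_lt_top k)).ne
  refine prekopa_leindler_real_of_bounded hp hq hpq (hf.min measurable_const)
    (hg.min measurable_const) hh (hb f m) (hb g n) fun x y => le_trans ?_ (H x y)
  gcongr <;> exact min_le_left _ _

/-- **Prékopa–Leindler inequality** on `Fin n → ℝ`. -/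
theorem prekopa_leindler_pi {p q : ℝ} (hp : 0 < p) (hq : 0 < q) (hpq : p + q = 1) (n : ℕ)
    {f g h : (Fin n → ℝ) → ℝ≥0∞} (hf : Measurable f) (hg : Measurable g) (hh : Measurable h)
    (H : ∀ x y, f x ^ p * g y ^ q ≤ h (p • x + q • y)) :
    (∫⁻ x, f x) ^ p * (∫⁻ x, g x) ^ q ≤ ∫⁻ x, h x := by
  induction n with
  | zero =>
    simp only [Measure.volume_pi_eq_dirac (0 : Fin 0 → ℝ), lintegral_dirac]
    simpa using H 0 0
  | succ n ih =>
    let e := (MeasurableEquiv.piFinSuccAbove (fun _ : Fin (n + 1) => ℝ) 0).symm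
    have he : ∀ {φ : (Fin (n + 1) → ℝ) → ℝ≥0∞}, Measurable φ →
        ∫⁻ x, φ x = ∫⁻ t, ∫⁻ x, φ (e (t, x)) := by
      intro φ hφ
      rw [← lintegral_prod (fun z => φ (e z)) (hφ.comp e.measurable).aemeasurable]
      exact ((volume_preserving_piFinSuccAbove (fun _ : Fin (n + 1) => ℝ) 0).symm
        |>.lintegral_map_equiv φ e)
    have hint : ∀ {φ : (Fin (n + 1) → ℝ) → ℝ≥0∞}, Measurable φ →
        Measurable fun t => ∫⁻ x, φ (e (t, x)) := fun hφ =>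
      (hφ.comp e.measurable).lintegral_prod_right'
    have hsec : ∀ {φ : (Fin (n + 1) → ℝ) → ℝ≥0∞}, Measurable φ → ∀ t,
        Measurable fun x => φ (e (t, x)) := fun hφ t =>
      (hφ.comp e.measurable).comp measurable_prodMk_left
    have hadd : ∀ s t x y, e (p * s + q * t, p • x + q • y) = p • e (s, x) + q • e (t, y) := by
      intro s t x y
      ext i
      refine Fin.cases ?_ (fun j => ?_) i <;> simp [e, MeasurableEquiv.piFinSuccAbove]
    rw [he hf, he hg, he hh]
    refine prekopa_leindler_real hp hq hpq (hint hf) (hint hg) (hint hh) fun s t => ?_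
    refine ih (hsec hf s) (hsec hg t) (hsec hh _) fun x y => ?_
    rw [hadd]
    exact H _ _

/-- **Prékopa–Leindler inequality** on Euclidean space. -/
theorem prekopa_leindler_euclideanSpace {p q : ℝ} (hp : 0 < p) (hq : 0 < q) (hpq : p + q = 1)
    {n : ℕ} {f g h : EuclideanSpace ℝ (Fin n) → ℝ≥0∞} (hf : Measurable f) (hg : Measurable g)
    (hh : Measurable h) (H : ∀ x y, f x ^ p * g y ^ q ≤ h (p • x + q • y)) :
    (∫⁻ x, f x) ^ p * (∫⁻ x, g x) ^ q ≤ ∫⁻ x, h x := by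
  have hT := PiLp.volume_preserving_toLp (Fin n)
  rw [← hT.lintegral_comp hf, ← hT.lintegral_comp hg, ← hT.lintegral_comp hh]
  refine prekopa_leindler_pi hp hq hpq n (hf.comp hT.measurable) (hg.comp hT.measurable)
    (hh.comp hT.measurable) fun x y => ?_
  simpa using H (WithLp.toLp 2 x) (WithLp.toLp 2 y)

lemma lintegral_ofReal_pow_mul_comp_smul {n : ℕ} {u : EuclideanSpace ℝ (Fin n) → ℝ}
    (hu : Measurable u) {c : ℝ} (hc : 0 < c) :
    ∫⁻ x, ENNReal.ofReal (c ^ n * u (c • x)) = ∫⁻ x, ENNReal.ofReal (u x) := by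
  have h := lintegral_map (μ := volume) hu.ennreal_ofReal
    (measurable_const_smul c : Measurable fun x : EuclideanSpace ℝ (Fin n) => c • x)
  rw [Measure.map_addHaar_smul _ hc.ne', lintegral_smul_measure, finrank_euclideanSpace,
    Fintype.card_fin, abs_of_pos (by positivity)] at h
  simp_rw [ENNReal.ofReal_mul (pow_nonneg hc.le n)]
  rw [lintegral_const_mul _ (by fun_prop), ← h, smul_eq_mul, ← mul_assoc,
    ← ENNReal.ofReal_mul (by positivity), mul_inv_cancel₀ (by positivity), ENNReal.ofReal_one,
    one_mul]

theorem prekopa_leindler_type_flat_case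
    (n : ℕ) (hn : 1 ≤ n) (τ₁ τbar τ₂ : ℝ) (hτ₁ : 0 < τ₁) (hτ₁bar : τ₁ < τbar)
    (hτbar₂ : τbar < τ₂) (l : ℝ) (hl : l ∈ Ioo (0 : ℝ) 1)
    (hlam : 1 / Real.sqrt τbar = (1 - l) / Real.sqrt τ₁ + l / Real.sqrt τ₂)
    (u₁ u₂ v : EuclideanSpace ℝ (Fin n) → ℝ)
    (hu₁m : Measurable u₁) (hu₂m : Measurable u₂) (hvm : Measurable v)
    (hu₁0 : ∀ x, 0 ≤ u₁ x) (hu₂0 : ∀ x, 0 ≤ u₂ x) (hv0 : ∀ x, 0 ≤ v x)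
    -- the pointwise hypothesis along each minimizing flat L-geodesic
    (hyp : ∀ x y : EuclideanSpace ℝ (Fin n),
      ∀ z : EuclideanSpace ℝ (Fin n),
        z = x + ((Real.sqrt τbar - Real.sqrt τ₁) / (Real.sqrt τ₂ - Real.sqrt τ₁)) • (y - x) →
        (τbar / (τ₁ ^ (1 - l) * τ₂ ^ l)) ^ ((n : ℝ) / 2) * v z ≥
          Real.exp (-((1 - l) / (2 * Real.sqrt τ₁)) *
              (‖x - z‖ ^ 2 / (2 * (Real.sqrt τbar - Real.sqrt τ₁)))) * u₁ x ^ (1 - l) *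
          (Real.exp ((l / (2 * Real.sqrt τ₂)) *
              (‖z - y‖ ^ 2 / (2 * (Real.sqrt τ₂ - Real.sqrt τbar)))) * u₂ y ^ l)) :
    (∫⁻ x, ENNReal.ofReal (v x)) ≥
      (∫⁻ x, ENNReal.ofReal (u₁ x)) ^ (1 - l) * (∫⁻ x, ENNReal.ofReal (u₂ x)) ^ l := by
  obtain ⟨hl0, hl1⟩ := hl
  have hp : 0 < 1 - l := by linarith
  obtain ⟨a, ha, rfl⟩ : ∃ a : ℝ, 0 < a ∧ τ₁ = a ^ 2 :=
    ⟨√τ₁, Real.sqrt_pos.2 hτ₁, (Real.sq_sqrt hτ₁.le).symm⟩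
  have hτbar : 0 < τbar := hτ₁.trans hτ₁bar
  obtain ⟨m, hm, rfl⟩ : ∃ m : ℝ, 0 < m ∧ τbar = m ^ 2 :=
    ⟨√τbar, Real.sqrt_pos.2 hτbar, (Real.sq_sqrt hτbar.le).symm⟩
  have hτ₂ : 0 < τ₂ := hτbar.trans hτbar₂
  obtain ⟨b, hb, rfl⟩ : ∃ b : ℝ, 0 < b ∧ τ₂ = b ^ 2 :=
    ⟨√τ₂, Real.sqrt_pos.2 hτ₂, (Real.sq_sqrt hτ₂.le).symm⟩
  have ham : a < m := lt_of_pow_lt_pow_left₀ 2 hm.le hτ₁bar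
  have hmb : m < b := lt_of_pow_lt_pow_left₀ 2 hb.le hτbar₂
  simp only [Real.sqrt_sq ha.le, Real.sqrt_sq hm.le, Real.sqrt_sq hb.le] at hlam hyp
  have hrel : a * b = m * ((1 - l) * b + l * a) := by
    field_simp at hlam
    linarith
  have hba : b - a ≠ 0 := by linarith
  have hs : (m - a) / (b - a) = m * l / b := by
    rw [div_eq_div_iff hba hb.ne']
    linear_combination (-1) * hrel
  have hma : m - a = m * l / b * (b - a) := by rw [← hs]; field_simp
  have hbm : b - m = m * (1 - l) / a * (b - a) := by
    field_simp
    linear_combination hrel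
  have hs' : 1 - m * l / b = m * (1 - l) / a := by
    field_simp
    linear_combination hrel
  rw [hs] at hyp
  rw [ge_iff_le, ← lintegral_ofReal_pow_mul_comp_smul hu₁m ha,
    ← lintegral_ofReal_pow_mul_comp_smul hu₂m hb, ← lintegral_ofReal_pow_mul_comp_smul hvm hm]
  refine prekopa_leindler_euclideanSpace hp hl0 (by ring) (by fun_prop) (by fun_prop)
    (by fun_prop) fun x y => ?_
  have h₁ : 0 ≤ a ^ n * u₁ (a • x) := mul_nonneg (by positivity) (hu₁0 _)
  have h₂ : 0 ≤ b ^ n * u₂ (b • y) := mul_nonneg (by positivity) (hu₂0 _)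
  rw [ENNReal.ofReal_rpow_of_nonneg h₁ hp.le, ENNReal.ofReal_rpow_of_nonneg h₂ hl0.le,
    ← ENNReal.ofReal_mul (by positivity)]
  refine ENNReal.ofReal_le_ofReal ?_
  have hz : m • ((1 - l) • x + l • y) = a • x + (m * l / b) • (b • y - a • x) := by
    have e1 : (m * l / b) • (b • y - a • x) = (m * l) • y - (m * l / b * a) • x := by
      rw [smul_sub, smul_smul, smul_smul, div_mul_cancel₀ _ hb.ne']
    have e2 : m * (1 - l) = a - m * l / b * a := by
      field_simp at hs' ⊢
      linear_combination (-1) * hs'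
    rw [e1, smul_add, smul_smul, smul_smul, e2]
    module
  have key := hyp (a • x) (b • y) _ hz
  set d := ‖b • y - a • x‖ with hd
  have hxz : ‖a • x - m • ((1 - l) • x + l • y)‖ = m * l / b * d := by
    rw [hz, sub_add_cancel_left, norm_neg, norm_smul, Real.norm_of_nonneg (by positivity)]
  have hzy : ‖m • ((1 - l) • x + l • y) - b • y‖ = m * (1 - l) / a * d := by
    have : m • ((1 - l) • x + l • y) - b • y =
        -((1 - m * l / b) • (b • y - a • x)) := by rw [hz]; module
    rw [this, hs', norm_neg, norm_smul, Real.norm_of_nonneg (by positivity)]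
  rw [hxz, hzy, hma, hbm] at key
  have hexp : -((1 - l) / (2 * a)) * ((m * l / b * d) ^ 2 / (2 * (m * l / b * (b - a)))) +
      l / (2 * b) * ((m * (1 - l) / a * d) ^ 2 / (2 * (m * (1 - l) / a * (b - a)))) = 0 := by
    field_simp
    ring
  have hfac : (m ^ 2 / ((a ^ 2) ^ (1 - l) * (b ^ 2) ^ l)) ^ ((n : ℝ) / 2) =
      m ^ n / ((a ^ n) ^ (1 - l) * (b ^ n) ^ l) := by
    simp only [← Real.rpow_natCast]
    rw [Real.div_rpow (by positivity) (by positivity),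
      Real.mul_rpow (by positivity) (by positivity)]
    simp only [← Real.rpow_mul ha.le, ← Real.rpow_mul hb.le, ← Real.rpow_mul hm.le]
    push_cast
    congr! 3 <;> ring
  have hcomb : ∀ A B U V : ℝ, A + B = 0 →
      Real.exp A * U * (Real.exp B * V) = U * V := by
    intro A B U V h
    rw [mul_mul_mul_comm, ← Real.exp_add, h, Real.exp_zero, one_mul]
  rw [hcomb _ _ _ _ hexp, hfac, ge_iff_le, div_mul_eq_mul_div, le_div_iff₀ (by positivity)] at key
  rw [Real.mul_rpow (by positivity) (hu₁0 _), Real.mul_rpow (by positivity) (hu₂0 _)]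
  linarith
end

section
/- Let n ≥ 1 and let 0 < τ̄₁ < τ̄₂. Let I ⊂ (0,∞) be an open interval and for i = 1,2 let uᵢ : ℝⁿ × I → (0,∞) be smooth solutions of the heat equation ∂uᵢ/∂τ = Δuᵢ such that for each τ ∈ I the function x ↦ uᵢ(x,τ) is a Schwartz-class probability density. For probability measures μ, ν on ℝⁿ with finite second moments let W₂²(μ,ν) denote the infimum of ∫_{ℝⁿ×ℝⁿ} ‖x-y‖² dπ(x,y) over all Borel probability measures π on ℝⁿ×ℝⁿ whose first marginal is μ and second marginal is ν. Then the function s ↦ W₂²(u₁(·,τ̄₁e^s)·Leb, u₂(·,τ̄₂e^s)·Leb) - 2n·(√(τ̄₂e^s) - √(τ̄₁e^s))² is nonincreasing on the set of s ∈ ℝ with τ̄₁e^s, τ̄₂e^s ∈ I. -/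
open Set MeasureTheory

theorem ContDiff.fderiv_apply_const {E F : Type*} [NormedAddCommGroup E] [NormedSpace ℝ E]
    [NormedAddCommGroup F] [NormedSpace ℝ F] {f : E → F} (hf : ContDiff ℝ (⊤ : ℕ∞) f) (v : E) :
    ContDiff ℝ (⊤ : ℕ∞) (fun x => fderiv ℝ f x v) :=
  (hf.fderiv_right (m := (⊤ : ℕ∞)) (by simp)).clm_apply contDiff_const

theorem integral_smul_fderiv_fderiv_of_hasCompactSupport {E : Type*} [NormedAddCommGroup E]
    [NormedSpace ℝ E] [FiniteDimensional ℝ E] [MeasurableSpace E] [BorelSpace E]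
    {μ : Measure E} [μ.IsAddHaarMeasure] {f : E → ℝ} {g : E → ℂ}
    (hf : ContDiff ℝ (⊤ : ℕ∞) f) (hg : ContDiff ℝ (⊤ : ℕ∞) g) (hgc : HasCompactSupport g) (v : E) :
    ∫ x, f x • fderiv ℝ (fun y => fderiv ℝ g y v) x v ∂μ =
      ∫ x, fderiv ℝ (fun y => fderiv ℝ f y v) x v • g x ∂μ := by
  have parts : ∀ {f : E → ℝ} {g : E → ℂ}, ContDiff ℝ (⊤ : ℕ∞) f → ContDiff ℝ (⊤ : ℕ∞) g →
      HasCompactSupport g →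
      ∫ x, f x • fderiv ℝ g x v ∂μ = - ∫ x, fderiv ℝ f x v • g x ∂μ := by
    intro f g hf hg hgc
    refine integral_smul_fderiv_eq_neg_fderiv_smul_of_integrable ?_ ?_ ?_
      (fun x _ => hf.differentiable (by simp) x) (fun x _ => hg.differentiable (by simp) x)
    · exact ((hf.fderiv_apply_const v).continuous.smul hg.continuous).integrable_of_hasCompactSupport
        hgc.smul_left
    · exact (hf.continuous.smul (hg.fderiv_apply_const v).continuous).integrable_of_hasCompactSupport
        (hgc.fderiv_apply (𝕜 := ℝ) v).smul_left
    · exact (hf.continuous.smul hg.continuous).integrable_of_hasCompactSupport hgc.smul_left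
  rw [parts hf (hg.fderiv_apply_const v) (hgc.fderiv_apply (𝕜 := ℝ) v),
    parts (hf.fderiv_apply_const v) hg hgc, neg_neg]

theorem hasDerivAt_integral_smul_of_contDiffOn {E : Type*} [NormedAddCommGroup E]
    [NormedSpace ℝ E] [MeasurableSpace E] [BorelSpace E]
    {μ : Measure E} [IsFiniteMeasureOnCompacts μ] {u : E → ℝ → ℝ} {I : Set ℝ} (hI : IsOpen I)
    (hu : ContDiffOn ℝ (⊤ : ℕ∞) (fun p : E × ℝ => u p.1 p.2) (univ ×ˢ I))
    {g : E → ℂ} (hg : Continuous g) (hgc : HasCompactSupport g) {τ : ℝ} (hτ : τ ∈ I) :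
    HasDerivAt (fun t => ∫ x, u x t • g x ∂μ) (∫ x, deriv (fun t => u x t) τ • g x ∂μ) τ := by
  have hopen : IsOpen ((univ : Set E) ×ˢ I) := isOpen_univ.prod hI
  set U : E × ℝ → ℝ := fun p => u p.1 p.2 with hU
  have hderiv : ∀ x, ∀ t ∈ I, HasDerivAt (fun t => u x t) (fderiv ℝ U (x, t) (0, 1)) t := by
    intro x t ht
    have h1 : HasFDerivAt U (fderiv ℝ U (x, t)) (x, t) :=
      ((hu.contDiffAt (hopen.mem_nhds ⟨mem_univ x, ht⟩)).differentiableAt (by simp)).hasFDerivAt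
    exact h1.comp_hasDerivAt t ((hasDerivAt_const t x).prodMk (hasDerivAt_id t))
  have hcont : ContinuousOn (fun p : E × ℝ => fderiv ℝ U p (0, 1)) (univ ×ˢ I) :=
    (hu.continuousOn_fderiv_of_isOpen hopen (by simp)).clm_apply continuousOn_const
  obtain ⟨r, hr, hrI⟩ := Metric.nhds_basis_closedBall.mem_iff.1 (hI.mem_nhds hτ)
  obtain ⟨C, hC⟩ := (hgc.isCompact.prod (isCompact_closedBall τ r)).exists_bound_of_continuousOn
    (hcont.mono (prod_mono (subset_univ _) hrI))
  have slice : ∀ t ∈ I, Continuous fun x => u x t := fun t ht =>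
    hu.continuousOn.comp_continuous (f := fun x : E => (x, t)) (by fun_prop) fun x => ⟨mem_univ x, ht⟩
  have slice' : Continuous fun x => fderiv ℝ U (x, τ) (0, 1) :=
    hcont.comp_continuous (f := fun x : E => (x, τ)) (by fun_prop) fun x => ⟨mem_univ x, hτ⟩
  have key := hasDerivAt_integral_of_dominated_loc_of_deriv_le (μ := μ)
    (F := fun t x => u x t • g x) (F' := fun t x => fderiv ℝ U (x, t) (0, 1) • g x)
    (bound := fun x => C * ‖g x‖) (Metric.closedBall_mem_nhds τ hr) ?_ ?_ ?_ ?_ ?_ ?_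
  · simpa only [(hderiv _ τ hτ).deriv] using key.2
  · filter_upwards [hI.mem_nhds hτ] with t ht
    exact (((slice t ht).smul hg).stronglyMeasurable_of_hasCompactSupport
      hgc.smul_left).aestronglyMeasurable
  · exact ((slice τ hτ).smul hg).integrable_of_hasCompactSupport hgc.smul_left
  · exact ((slice'.smul hg).stronglyMeasurable_of_hasCompactSupport
      hgc.smul_left).aestronglyMeasurable
  · refine .of_forall fun x t ht => ?_
    rw [norm_smul]
    by_cases hx : x ∈ tsupport g
    · gcongr
      exact hC (x, t) ⟨hx, ht⟩
    · simp [image_eq_zero_of_notMem_tsupport hx]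
  · exact (hg.norm.integrable_of_hasCompactSupport hgc.norm).const_mul C
  · exact .of_forall fun x t ht => (hderiv x t (hrI ht)).smul_const (g x)

theorem hasDerivAt_integral_smul_of_heat {n : ℕ} {u : EuclideanSpace ℝ (Fin n) → ℝ → ℝ}
    {I : Set ℝ} (hI : IsOpen I)
    (hu : ContDiffOn ℝ (⊤ : ℕ∞) (fun p : EuclideanSpace ℝ (Fin n) × ℝ => u p.1 p.2) (univ ×ˢ I))
    (hheat : ∀ x, ∀ τ ∈ I, deriv (fun t => u x t) τ =
      ∑ j : Fin n, fderiv ℝ (fun y => fderiv ℝ (fun z => u z τ) y (EuclideanSpace.single j 1)) x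
        (EuclideanSpace.single j 1))
    {g : EuclideanSpace ℝ (Fin n) → ℂ} (hg : ContDiff ℝ (⊤ : ℕ∞) g) (hgc : HasCompactSupport g)
    {τ : ℝ} (hτ : τ ∈ I) :
    HasDerivAt (fun t => ∫ x, u x t • g x)
      (∫ x, u x τ • ∑ j : Fin n, fderiv ℝ
        (fun y => fderiv ℝ g y (EuclideanSpace.single j 1)) x (EuclideanSpace.single j 1)) τ := by
  have hslice : ContDiff ℝ (⊤ : ℕ∞) (fun x => u x τ) :=
    hu.comp_contDiff (f := fun x => (x, τ)) (by fun_prop) fun x => ⟨mem_univ x, hτ⟩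
  convert hasDerivAt_integral_smul_of_contDiffOn (μ := volume) hI hu hg.continuous hgc hτ using 1
  simp_rw [hheat _ τ hτ, Finset.smul_sum, Finset.sum_smul]
  rw [integral_finsetSum, integral_finsetSum]
  · exact Finset.sum_congr rfl fun j _ =>
      integral_smul_fderiv_fderiv_of_hasCompactSupport hslice hg hgc _
  · exact fun j _ => (((hslice.fderiv_apply_const _).fderiv_apply_const _).continuous.smul
      hg.continuous).integrable_of_hasCompactSupport hgc.smul_left
  · exact fun j _ => (hslice.continuous.smul ((hg.fderiv_apply_const _).fderiv_apply_const
      _).continuous).integrable_of_hasCompactSupport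
      ((hgc.fderiv_apply (𝕜 := ℝ) _).fderiv_apply (𝕜 := ℝ) _).smul_left

theorem contDiff_comp_smul_mul_cexp {E : Type*} [NormedAddCommGroup E] [InnerProductSpace ℝ E]
    {ψ : E → ℂ} (hψ : ContDiff ℝ (⊤ : ℕ∞) ψ) (k : E) (ε : ℝ) :
    ContDiff ℝ (⊤ : ℕ∞) fun x => ψ (ε • x) * Complex.exp (inner ℝ x k * Complex.I) := by
  have h : ContDiff ℝ (⊤ : ℕ∞) fun x : E => ((inner ℝ x k : ℝ) : ℂ) :=
    Complex.ofRealCLM.contDiff.comp (contDiff_id.inner ℝ contDiff_const)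
  exact (hψ.comp (contDiff_id.const_smul ε)).mul (h.mul contDiff_const).cexp

theorem fderiv_comp_smul_mul_cexp {E : Type*} [NormedAddCommGroup E] [InnerProductSpace ℝ E]
    {ψ : E → ℂ} (hψ : ContDiff ℝ (⊤ : ℕ∞) ψ) (k v : E) (ε : ℝ) (x : E) :
    fderiv ℝ (fun x => ψ (ε • x) * Complex.exp (inner ℝ x k * Complex.I)) x v =
      ε * (fderiv ℝ ψ (ε • x) v * Complex.exp (inner ℝ x k * Complex.I)) +
        inner ℝ v k * Complex.I * (ψ (ε • x) * Complex.exp (inner ℝ x k * Complex.I)) := by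
  have h1 : HasFDerivAt (fun x => ψ (ε • x))
      ((fderiv ℝ ψ (ε • x)).comp (ε • ContinuousLinearMap.id ℝ E)) x :=
    (hψ.differentiable (by simp) (ε • x)).hasFDerivAt.comp x ((hasFDerivAt_id x).const_smul ε)
  have h2 : HasFDerivAt (fun x : E => ((inner ℝ x k : ℝ) : ℂ))
      (Complex.ofRealCLM.comp ((innerSL ℝ).flip k)) x :=
    Complex.ofRealCLM.hasFDerivAt.comp x ((innerSL ℝ).flip k).hasFDerivAt
  rw [(h1.fun_mul (h2.mul_const Complex.I).cexp).fderiv]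
  simp only [add_apply, ContinuousLinearMap.comp_apply, ContinuousLinearMap.flip_apply, smul_apply,
    ContinuousLinearMap.id_apply, map_smul, Complex.real_smul, smul_eq_mul,
    Complex.ofRealCLM_apply, innerSL_apply_apply]
  ring

theorem exists_norm_laplacian_comp_smul_mul_cexp_le {n : ℕ} {ψ : EuclideanSpace ℝ (Fin n) → ℂ}
    (hψ : ContDiff ℝ (⊤ : ℕ∞) ψ) (hψc : HasCompactSupport ψ) (k : EuclideanSpace ℝ (Fin n)) :
    ∃ C : ℝ, ∀ ε ∈ Ioc (0 : ℝ) 1, ∀ x,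
      ‖∑ j : Fin n, fderiv ℝ (fun y => fderiv ℝ
          (fun z => ψ (ε • z) * Complex.exp (inner ℝ z k * Complex.I)) y
            (EuclideanSpace.single j 1)) x (EuclideanSpace.single j 1)
        + ‖k‖ ^ 2 * (ψ (ε • x) * Complex.exp (inner ℝ x k * Complex.I))‖ ≤ C * ε := by
  have bound : ∀ {φ : EuclideanSpace ℝ (Fin n) → ℂ}, Continuous φ → HasCompactSupport φ →
      ∃ M, ∀ x, ‖φ x‖ ≤ M := fun hφ hφc => hφc.exists_bound_of_continuous hφ
  let e (j : Fin n) : EuclideanSpace ℝ (Fin n) := EuclideanSpace.single j 1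
  have hψ1 (j : Fin n) := hψ.fderiv_apply_const (e j)
  have hψ2 (j : Fin n) := (hψ1 j).fderiv_apply_const (e j)
  choose M₁ hM₁ using fun j => bound (hψ1 j).continuous (hψc.fderiv_apply (𝕜 := ℝ) (e j))
  choose M₂ hM₂ using fun j => bound (hψ2 j).continuous
    ((hψc.fderiv_apply (𝕜 := ℝ) (e j)).fderiv_apply (𝕜 := ℝ) (e j))
  have hk : ((‖k‖ : ℂ)) ^ 2 = ∑ j, ((k j : ℝ) : ℂ) ^ 2 := by
    have := EuclideanSpace.real_norm_sq_eq k
    exact_mod_cast this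
  refine ⟨∑ j, (M₂ j + 2 * |k j| * M₁ j), fun ε hε x => ?_⟩
  rw [hk, Finset.sum_mul, ← Finset.sum_add_distrib, Finset.sum_mul]
  refine norm_sum_le_of_le _ fun j _ => ?_
  have hinner : inner ℝ (e j) k = k j := by simp [e, EuclideanSpace.inner_single_left]
  have expand : fderiv ℝ (fun y => fderiv ℝ
          (fun z => ψ (ε • z) * Complex.exp (inner ℝ z k * Complex.I)) y (e j)) x (e j)
        + ((k j : ℝ) : ℂ) ^ 2 * (ψ (ε • x) * Complex.exp (inner ℝ x k * Complex.I)) =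
      ε * ((ε * fderiv ℝ (fun y => fderiv ℝ ψ y (e j)) (ε • x) (e j)
        + 2 * k j * Complex.I * fderiv ℝ ψ (ε • x) (e j)) *
          Complex.exp (inner ℝ x k * Complex.I)) := by
    simp_rw [fderiv_comp_smul_mul_cexp hψ k (e j) ε]
    have d1 := (contDiff_comp_smul_mul_cexp (hψ1 j) k ε).differentiable (by simp) x
    have d2 := (contDiff_comp_smul_mul_cexp hψ k ε).differentiable (by simp) x
    rw [fderiv_fun_add (d1.const_mul _) (d2.const_mul _), fderiv_const_mul d1, fderiv_const_mul d2]
    simp only [add_apply, smul_apply, smul_eq_mul]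
    rw [fderiv_comp_smul_mul_cexp hψ k (e j) ε, fderiv_comp_smul_mul_cexp (hψ1 j) k (e j) ε, hinner]
    linear_combination (-1 : ℂ) * (((k j : ℝ) : ℂ) ^ 2 *
      (ψ (ε • x) * Complex.exp (inner ℝ x k * Complex.I))) * (-Complex.I_sq)
  rw [expand, norm_mul, norm_mul, Complex.norm_exp_ofReal_mul_I, mul_one, Complex.norm_real,
    Real.norm_of_nonneg hε.1.le, mul_comm]
  refine mul_le_mul_of_nonneg_right ((norm_add_le _ _).trans (add_le_add ?_ ?_)) hε.1.le
  · rw [norm_mul, Complex.norm_real, Real.norm_of_nonneg hε.1.le]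
    exact (mul_le_of_le_one_left (norm_nonneg _) hε.2).trans (hM₂ j _)
  · simp only [norm_mul, Complex.norm_ofNat, Complex.norm_real, Real.norm_eq_abs, Complex.norm_I,
      mul_one]
    gcongr
    exact hM₁ j _

/-- A smooth solution of the heat equation on `ℝⁿ × I` consisting of probability densities. -/
structure IsHeatDensity {n : ℕ} (u : EuclideanSpace ℝ (Fin n) → ℝ → ℝ) (I : Set ℝ) : Prop where
  contDiffOn :
    ContDiffOn ℝ (⊤ : ℕ∞) (fun p : EuclideanSpace ℝ (Fin n) × ℝ => u p.1 p.2) (univ ×ˢ I)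
  nonneg : ∀ x, ∀ τ ∈ I, 0 ≤ u x τ
  deriv_eq : ∀ x, ∀ τ ∈ I, deriv (fun t => u x t) τ =
    ∑ j : Fin n, fderiv ℝ (fun y => fderiv ℝ (fun z => u z τ) y (EuclideanSpace.single j 1)) x
      (EuclideanSpace.single j 1)
  integral_eq_one : ∀ τ ∈ I, ∫ x, u x τ = 1

namespace IsHeatDensity

variable {n : ℕ} {u : EuclideanSpace ℝ (Fin n) → ℝ → ℝ} {I : Set ℝ} {s t : ℝ}

theorem integrable (hu : IsHeatDensity u I) (ht : t ∈ I) : Integrable fun x => u x t :=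
  integrable_of_integral_eq_one (hu.integral_eq_one t ht)

theorem continuous (hu : IsHeatDensity u I) (ht : t ∈ I) : Continuous fun x => u x t :=
  hu.contDiffOn.continuousOn.comp_continuous
    (f := fun x : EuclideanSpace ℝ (Fin n) => (x, t)) (by fun_prop) fun x => ⟨mem_univ x, ht⟩

theorem isProbabilityMeasure (hu : IsHeatDensity u I) (ht : t ∈ I) :
    IsProbabilityMeasure (volume.withDensity fun x => ENNReal.ofReal (u x t)) := by
  constructor
  rw [withDensity_apply _ MeasurableSet.univ, setLIntegral_univ,
    ← ofReal_integral_eq_lintegral_ofReal (hu.integrable ht) (.of_forall fun x => hu.nonneg x t ht),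
    hu.integral_eq_one t ht, ENNReal.ofReal_one]

theorem integral_withDensity (hu : IsHeatDensity u I) (ht : t ∈ I)
    (g : EuclideanSpace ℝ (Fin n) → ℂ) :
    ∫ x, g x ∂volume.withDensity (fun x => ENNReal.ofReal (u x t)) = ∫ x, u x t • g x := by
  rw [integral_withDensity_eq_integral_toReal_smul (by have := hu.continuous ht; fun_prop)
    (.of_forall fun x => ENNReal.ofReal_lt_top)]
  simp_rw [ENNReal.toReal_ofReal (hu.nonneg _ t ht)]

theorem norm_integral_smul_le (hu : IsHeatDensity u I) (ht : t ∈ I)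
    {g : EuclideanSpace ℝ (Fin n) → ℂ} {C : ℝ} (hg : ∀ x, ‖g x‖ ≤ C) :
    ‖∫ x, u x t • g x‖ ≤ C := by
  calc ‖∫ x, u x t • g x‖ ≤ ∫ x, u x t * C := by
        refine norm_integral_le_of_norm_le ((hu.integrable ht).mul_const C) (.of_forall fun x => ?_)
        rw [norm_smul, Real.norm_of_nonneg (hu.nonneg x t ht)]
        exact mul_le_mul_of_nonneg_left (hg x) (hu.nonneg x t ht)
    _ = C := by rw [integral_mul_const, hu.integral_eq_one t ht, one_mul]

theorem norm_integral_smul_cutoff_sub_le (hu : IsHeatDensity u I) (hI : IsOpen I)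
    (hst : s ≤ t) (hsub : Icc s t ⊆ I)
    {ψ : EuclideanSpace ℝ (Fin n) → ℂ} (hψ : ContDiff ℝ (⊤ : ℕ∞) ψ) (hψc : HasCompactSupport ψ)
    (k : EuclideanSpace ℝ (Fin n)) :
    ∃ C : ℝ, ∀ ε ∈ Ioc (0 : ℝ) 1,
      ‖Complex.exp (‖k‖ ^ 2 * t) *
          (∫ x, u x t • (ψ (ε • x) * Complex.exp (inner ℝ x k * Complex.I)))
        - Complex.exp (‖k‖ ^ 2 * s) *
          (∫ x, u x s • (ψ (ε • x) * Complex.exp (inner ℝ x k * Complex.I)))‖ ≤ C * ε := by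
  obtain ⟨C, hC⟩ := exists_norm_laplacian_comp_smul_mul_cexp_le hψ hψc k
  refine ⟨Real.exp (‖k‖ ^ 2 * t) * C * (t - s), fun ε hε => ?_⟩
  set g : EuclideanSpace ℝ (Fin n) → ℂ :=
    fun x => ψ (ε • x) * Complex.exp (inner ℝ x k * Complex.I) with hg_def
  have hg : ContDiff ℝ (⊤ : ℕ∞) g := contDiff_comp_smul_mul_cexp hψ k ε
  have hgc : HasCompactSupport g := (hψc.comp_smul hε.1.ne').mul_right
  set Δg : EuclideanSpace ℝ (Fin n) → ℂ := fun x => ∑ j : Fin n, fderiv ℝ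
    (fun y => fderiv ℝ g y (EuclideanSpace.single j 1)) x (EuclideanSpace.single j 1) with hΔg
  have hderiv : ∀ τ ∈ Icc s t, HasDerivWithinAt
      (fun τ => Complex.exp (‖k‖ ^ 2 * (τ : ℝ)) * ∫ x, u x τ • g x)
      (Complex.exp (‖k‖ ^ 2 * (τ : ℝ)) * ∫ x, u x τ • (Δg x + ‖k‖ ^ 2 * g x)) (Icc s t) τ := by
    intro τ hτ
    have h1 := hasDerivAt_integral_smul_of_heat hI hu.contDiffOn hu.deriv_eq hg hgc (hsub hτ)
    have h2 : HasDerivAt (fun τ : ℝ => Complex.exp (‖k‖ ^ 2 * (τ : ℝ)))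
        (Complex.exp (‖k‖ ^ 2 * (τ : ℝ)) * ‖k‖ ^ 2) τ := by
      simpa using ((Complex.ofRealCLM.hasDerivAt (x := τ)).const_mul ((‖k‖ : ℂ) ^ 2)).cexp
    refine ((h2.mul h1).congr_deriv ?_).hasDerivWithinAt
    have hc := hu.continuous (hsub hτ)
    have i1 : Integrable fun x => u x τ • Δg x := by
      simp_rw [hΔg, Finset.smul_sum]
      exact integrable_finsetSum _ fun j _ =>
        (hc.smul ((hg.fderiv_apply_const _).fderiv_apply_const
          _).continuous).integrable_of_hasCompactSupport
          ((hgc.fderiv_apply (𝕜 := ℝ) _).fderiv_apply (𝕜 := ℝ) _).smul_left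
    have i2 : Integrable fun x => u x τ • g x :=
      (hc.smul hg.continuous).integrable_of_hasCompactSupport hgc.smul_left
    simp_rw [smul_add, ← mul_smul_comm]
    rw [integral_add i1 (i2.const_mul _), integral_const_mul]
    ring
  have hbound : ∀ τ ∈ Icc s t,
      ‖Complex.exp (‖k‖ ^ 2 * (τ : ℝ)) * ∫ x, u x τ • (Δg x + ‖k‖ ^ 2 * g x)‖ ≤
        Real.exp (‖k‖ ^ 2 * t) * (C * ε) := by
    intro τ hτ
    have hnorm : ‖Complex.exp (‖k‖ ^ 2 * (τ : ℝ))‖ = Real.exp (‖k‖ ^ 2 * τ) := by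
      rw [← Complex.ofReal_pow, ← Complex.ofReal_mul, Complex.norm_exp_ofReal]
    rw [norm_mul, hnorm]
    have := hτ.2
    gcongr
    exact hu.norm_integral_smul_le (hsub hτ) (hC ε hε)
  have := (convex_Icc s t).norm_image_sub_le_of_norm_hasDerivWithin_le hderiv hbound
    (left_mem_Icc.2 hst) (right_mem_Icc.2 hst)
  rw [Real.norm_of_nonneg (sub_nonneg.2 hst)] at this
  exact this.trans_eq (by ring)

theorem charFun_eq (hu : IsHeatDensity u I) (hI : IsOpen I)
    (hst : s ≤ t) (hsub : Icc s t ⊆ I)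
    (k : EuclideanSpace ℝ (Fin n)) :
    charFun (volume.withDensity fun x => ENNReal.ofReal (u x t)) k =
      charFun (volume.withDensity fun x => ENNReal.ofReal (u x s)) k *
        Complex.exp (-‖k‖ ^ 2 * (t - s)) := by
  have hs : s ∈ I := hsub (left_mem_Icc.2 hst)
  have ht : t ∈ I := hsub (right_mem_Icc.2 hst)
  let b : ContDiffBump (0 : EuclideanSpace ℝ (Fin n)) := default
  let ψ : EuclideanSpace ℝ (Fin n) → ℂ := fun x => (b x : ℂ)
  have hψ : ContDiff ℝ (⊤ : ℕ∞) ψ := Complex.ofRealCLM.contDiff.comp b.contDiff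
  have hψc : HasCompactSupport ψ := b.hasCompactSupport.comp_left Complex.ofReal_zero
  have hψ0 : ψ 0 = 1 := by
    simp [ψ, b.one_of_mem_closedBall (Metric.mem_closedBall_self b.rIn_pos.le)]
  have hψ1 : ∀ x, ‖ψ x‖ ≤ 1 := fun x => by
    simpa [ψ, abs_of_nonneg b.nonneg] using b.le_one
  obtain ⟨C, hC⟩ := hu.norm_integral_smul_cutoff_sub_le hI hst hsub hψ hψc k
  have hlim : ∀ τ ∈ I, Filter.Tendsto
      (fun ε : ℝ => ∫ x, u x τ • (ψ (ε • x) * Complex.exp (inner ℝ x k * Complex.I)))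
      (nhdsWithin 0 (Ioi 0))
      (nhds (charFun (volume.withDensity fun x => ENNReal.ofReal (u x τ)) k)) := by
    intro τ hτ
    rw [charFun_apply, hu.integral_withDensity hτ]
    have hc := hu.continuous hτ
    have hψcont := hψ.continuous
    refine tendsto_integral_filter_of_dominated_convergence (fun x => u x τ)
      (.of_forall fun ε => ?_) (.of_forall fun ε => .of_forall fun x => ?_) (hu.integrable hτ)
      (.of_forall fun x => ?_)
    · exact Continuous.aestronglyMeasurable (by fun_prop)
    · rw [norm_smul, Real.norm_of_nonneg (hu.nonneg x τ hτ), norm_mul,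
        Complex.norm_exp_ofReal_mul_I, mul_one]
      exact mul_le_of_le_one_right (hu.nonneg x τ hτ) (hψ1 _)
    · have : Continuous fun ε : ℝ =>
          u x τ • (ψ (ε • x) * Complex.exp (inner ℝ x k * Complex.I)) := by fun_prop
      simpa [hψ0] using (this.tendsto 0).mono_left nhdsWithin_le_nhds
  have hlim_bound : Filter.Tendsto (fun ε : ℝ => C * ε) (nhdsWithin 0 (Ioi 0)) (nhds 0) := by
    simpa using ((continuous_const_mul C).tendsto 0).mono_left nhdsWithin_le_nhds
  have hle := le_of_tendsto_of_tendsto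
    (((hlim t ht).const_mul (Complex.exp (‖k‖ ^ 2 * t))).sub
      ((hlim s hs).const_mul (Complex.exp (‖k‖ ^ 2 * s)))).norm hlim_bound
    (Filter.mem_of_superset (Ioc_mem_nhdsGT one_pos) hC)
  rw [norm_le_zero_iff, sub_eq_zero] at hle
  have hexp : Complex.exp (-‖k‖ ^ 2 * (t - s)) =
      Complex.exp (‖k‖ ^ 2 * s) * Complex.exp (-(‖k‖ ^ 2 * t)) := by
    rw [← Complex.exp_add]; congr 1; ring
  rw [hexp, mul_left_comm, ← mul_assoc, ← hle, mul_right_comm, ← Complex.exp_add]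
  simp

theorem withDensity_eq_map_add (hu : IsHeatDensity u I) (hI : IsOpen I)
    (hst : s ≤ t) (hsub : Icc s t ⊆ I) :
    volume.withDensity (fun x => ENNReal.ofReal (u x t)) =
      ((volume.withDensity fun x => ENNReal.ofReal (u x s)).prod
        (ProbabilityTheory.stdGaussian (EuclideanSpace ℝ (Fin n)))).map
          fun p => p.1 + √(2 * (t - s)) • p.2 := by
  have := hu.isProbabilityMeasure (hsub (left_mem_Icc.2 hst))
  have := hu.isProbabilityMeasure (hsub (right_mem_Icc.2 hst))
  refine Measure.ext_of_charFun (funext fun k => ?_)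
  have : IsProbabilityMeasure ((ProbabilityTheory.stdGaussian (EuclideanSpace ℝ (Fin n))).map
    (√(2 * (t - s)) • ·)) := Measure.isProbabilityMeasure_map (by fun_prop)
  have hmap : ((volume.withDensity fun x => ENNReal.ofReal (u x s)).prod
        (ProbabilityTheory.stdGaussian (EuclideanSpace ℝ (Fin n)))).map
          (fun p => p.1 + √(2 * (t - s)) • p.2) =
      ((volume.withDensity fun x => ENNReal.ofReal (u x s)).prod
        ((ProbabilityTheory.stdGaussian (EuclideanSpace ℝ (Fin n))).map
          (√(2 * (t - s)) • ·))).map fun p => p.1 + p.2 := by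
    have h := Measure.map_prod_map (volume.withDensity fun x => ENNReal.ofReal (u x s))
      (ProbabilityTheory.stdGaussian (EuclideanSpace ℝ (Fin n))) measurable_id
      (measurable_const_smul √(2 * (t - s)))
    rw [Measure.map_id] at h
    rw [h, Measure.map_map (by fun_prop) (by fun_prop)]
    rfl
  rw [hmap, ProbabilityTheory.charFun_map_add_prod_eq_mul, Pi.mul_apply, charFun_map_smul,
    ProbabilityTheory.charFun_stdGaussian, hu.charFun_eq hI hst hsub]
  congr 2
  rw [norm_smul, Real.norm_of_nonneg (Real.sqrt_nonneg _), ← Complex.ofReal_pow (_ * _), mul_pow,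
    Real.sq_sqrt (by linarith)]
  push_cast
  ring

end IsHeatDensity

section Coupling

open ProbabilityTheory

variable {n : ℕ}

theorem integral_norm_sq_stdGaussian :
    ∫ z, ‖z‖ ^ 2 ∂stdGaussian (EuclideanSpace ℝ (Fin n)) = n := by
  have hcoord (j : Fin n) : ∫ z, z j ^ 2 ∂stdGaussian (EuclideanSpace ℝ (Fin n)) = 1 := by
    let L : StrongDual ℝ (EuclideanSpace ℝ (Fin n)) := innerSL ℝ (EuclideanSpace.single j 1)
    have hL (z) : L z = z j := by simp [L, EuclideanSpace.inner_single_left]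
    have h := variance_of_integral_eq_zero (by fun_prop) (integral_strongDual_stdGaussian L)
    rw [variance_dual_stdGaussian, innerSL_apply_norm, PiLp.norm_single] at h
    simpa [hL] using h.symm
  simp_rw [EuclideanSpace.real_norm_sq_eq]
  rw [integral_finsetSum]
  · simp [hcoord]
  · intro j _
    refine MemLp.integrable_sq ?_
    exact (EuclideanSpace.proj (𝕜 := ℝ) j).comp_memLp' IsGaussian.memLp_two_id

theorem integral_norm_add_smul_sq_prod_stdGaussian {Ω : Type*} [MeasurableSpace Ω]
    {π : Measure Ω} [IsProbabilityMeasure π] {w : Ω → EuclideanSpace ℝ (Fin n)}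
    (hw : MemLp w 2 π) (c : ℝ) :
    ∫ q, ‖w q.1 + c • q.2‖ ^ 2 ∂(π.prod (stdGaussian (EuclideanSpace ℝ (Fin n)))) =
      ∫ p, ‖w p‖ ^ 2 ∂π + n * c ^ 2 := by
  set γ := stdGaussian (EuclideanSpace ℝ (Fin n))
  have hw' : MemLp (fun q : Ω × EuclideanSpace ℝ (Fin n) => w q.1) 2 (π.prod γ) :=
    hw.comp_fst γ
  have hz : MemLp (fun q : Ω × EuclideanSpace ℝ (Fin n) => c • q.2) 2 (π.prod γ) :=
    (IsGaussian.memLp_two_id.comp_snd π).const_smul c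
  have i1 := hw'.norm.integrable_sq
  have i2 := hz.norm.integrable_sq
  have i3 : Integrable (fun q : Ω × EuclideanSpace ℝ (Fin n) => inner ℝ (w q.1) (c • q.2))
      (π.prod γ) := by
    refine (i1.add i2).mono' (hw'.1.inner hz.1) (.of_forall fun q => ?_)
    have := norm_inner_le_norm (𝕜 := ℝ) (w q.1) (c • q.2)
    simp only [Pi.add_apply]
    nlinarith [sq_nonneg (‖w q.1‖ - ‖c • q.2‖), sq_nonneg (‖w q.1‖ + ‖c • q.2‖)]
  have h1 : ∫ q, ‖w q.1‖ ^ 2 ∂(π.prod γ) = ∫ p, ‖w p‖ ^ 2 ∂π := by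
    simpa using integral_fun_fst (μ := π) (ν := γ) fun p => ‖w p‖ ^ 2
  have h2 : ∫ q, ‖c • q.2‖ ^ 2 ∂(π.prod γ) = n * c ^ 2 := by
    rw [integral_fun_snd (μ := π) (ν := γ) fun z => ‖c • z‖ ^ 2]
    simp [norm_smul, mul_pow, integral_const_mul, γ, integral_norm_sq_stdGaussian, mul_comm]
  have h3 : ∫ q, inner ℝ (w q.1) (c • q.2) ∂(π.prod γ) = 0 := by
    rw [integral_prod _ i3]
    refine integral_eq_zero_of_ae (.of_forall fun p => ?_)
    simpa [real_inner_smul_right, integral_const_mul] using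
      .inr (integral_strongDual_stdGaussian (innerSL ℝ (w p)))
  simp_rw [norm_add_sq_real]
  rw [integral_add (by exact i1.add (i3.const_mul 2)) i2, integral_add i1 (i3.const_mul 2),
    integral_const_mul, h1, h2, h3]
  ring

theorem exists_coupling_add_stdGaussian
    {π : Measure (EuclideanSpace ℝ (Fin n) × EuclideanSpace ℝ (Fin n))} [IsProbabilityMeasure π]
    (h₁ : MemLp id 2 (π.map Prod.fst)) (h₂ : MemLp id 2 (π.map Prod.snd)) (a b : ℝ) :
    ∃ π' : Measure (EuclideanSpace ℝ (Fin n) × EuclideanSpace ℝ (Fin n)),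
      IsProbabilityMeasure π' ∧
      π'.map Prod.fst = ((π.map Prod.fst).prod (stdGaussian _)).map (fun p => p.1 + a • p.2) ∧
      π'.map Prod.snd = ((π.map Prod.snd).prod (stdGaussian _)).map (fun p => p.1 + b • p.2) ∧
      ∫ p, ‖p.1 - p.2‖ ^ 2 ∂π' = ∫ p, ‖p.1 - p.2‖ ^ 2 ∂π + n * (a - b) ^ 2 := by
  set γ := stdGaussian (EuclideanSpace ℝ (Fin n))
  have hmarg : ∀ {f : EuclideanSpace ℝ (Fin n) × EuclideanSpace ℝ (Fin n) →
      EuclideanSpace ℝ (Fin n)}, Measurable f →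
      (π.map f).prod γ = (π.prod γ).map (Prod.map f id) := fun hf => by
    simpa using Measure.map_prod_map π γ hf measurable_id
  refine ⟨(π.prod γ).map fun q => (q.1.1 + a • q.2, q.1.2 + b • q.2),
    Measure.isProbabilityMeasure_map (by fun_prop), ?_, ?_, ?_⟩
  · rw [hmarg measurable_fst, Measure.map_map (by fun_prop) (by fun_prop),
      Measure.map_map (by fun_prop) (by fun_prop)]
    rfl
  · rw [hmarg measurable_snd, Measure.map_map (by fun_prop) (by fun_prop),
      Measure.map_map (by fun_prop) (by fun_prop)]
    rfl
  · rw [integral_map (by fun_prop) (Continuous.aestronglyMeasurable (by fun_prop))]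
    have m₁ : MemLp (fun p : EuclideanSpace ℝ (Fin n) × EuclideanSpace ℝ (Fin n) => p.1) 2 π :=
      (memLp_map_measure_iff h₁.1 (by fun_prop)).1 h₁
    have m₂ : MemLp (fun p : EuclideanSpace ℝ (Fin n) × EuclideanSpace ℝ (Fin n) => p.2) 2 π :=
      (memLp_map_measure_iff h₂.1 (by fun_prop)).1 h₂
    refine Eq.trans (integral_congr_ae (.of_forall fun q => ?_))
      (integral_norm_add_smul_sq_prod_stdGaussian (m₁.sub m₂) (a - b))
    simp only [Pi.sub_apply]
    congr 2
    module

end Coupling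

theorem SchwartzMap.memLp_two_id_withDensity {n : ℕ}
    (φ : SchwartzMap (EuclideanSpace ℝ (Fin n)) ℝ) :
    MemLp id 2 (volume.withDensity fun x => ENNReal.ofReal (φ x)) := by
  rw [memLp_two_iff_integrable_sq_norm aestronglyMeasurable_id,
    integrable_withDensity_iff_integrable_smul' (by fun_prop)
      (.of_forall fun x => ENNReal.ofReal_lt_top)]
  refine (φ.integrable_pow_mul volume 2).mono' (Measurable.aestronglyMeasurable (by fun_prop))
    (.of_forall fun x => ?_)
  rw [norm_smul, mul_comm, id, norm_pow, norm_norm, ENNReal.toReal_ofReal']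
  gcongr
  rw [Real.norm_of_nonneg (le_max_right _ _)]
  exact max_le (le_abs_self _) (norm_nonneg _)

theorem renormalized_wasserstein_monotonicity_heat_flow
    (n : ℕ) (hn : 1 ≤ n) (τbar₁ τbar₂ : ℝ) (hτ₁ : 0 < τbar₁) (hτ₁₂ : τbar₁ < τbar₂)
    (I : Set ℝ) (hIoo : ∃ a b : ℝ, I = Ioo a b) (hIpos : I ⊆ Ioi 0)
    (u₁ u₂ : EuclideanSpace ℝ (Fin n) → ℝ → ℝ)
    -- u₁, u₂ are smooth and positive on ℝⁿ × I
    (hsmooth : ∀ i ∈ ({u₁, u₂} : Set (EuclideanSpace ℝ (Fin n) → ℝ → ℝ)),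
      ContDiffOn ℝ (⊤ : ℕ∞) (fun p : EuclideanSpace ℝ (Fin n) × ℝ => i p.1 p.2) (univ ×ˢ I))
    (hpos : ∀ i ∈ ({u₁, u₂} : Set (EuclideanSpace ℝ (Fin n) → ℝ → ℝ)),
      ∀ x, ∀ τ ∈ I, 0 < i x τ)
    -- u₁, u₂ solve the heat equation ∂u/∂τ = Δu on ℝⁿ × I
    (hheat : ∀ i ∈ ({u₁, u₂} : Set (EuclideanSpace ℝ (Fin n) → ℝ → ℝ)),
      ∀ x, ∀ τ ∈ I,
        deriv (fun t => i x t) τ =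
          ∑ j : Fin n, fderiv ℝ
            (fun x' => fderiv ℝ (fun x'' => i x'' τ) x' (EuclideanSpace.single j 1)) x
            (EuclideanSpace.single j 1))
    -- for each τ ∈ I, x ↦ uᵢ(x,τ) is a Schwartz-class probability density
    (hschwartz : ∀ i ∈ ({u₁, u₂} : Set (EuclideanSpace ℝ (Fin n) → ℝ → ℝ)),
      ∀ τ ∈ I, ∃ φ : SchwartzMap (EuclideanSpace ℝ (Fin n)) ℝ, ∀ x, φ x = i x τ)
    (hprob : ∀ i ∈ ({u₁, u₂} : Set (EuclideanSpace ℝ (Fin n) → ℝ → ℝ)),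
      ∀ τ ∈ I, ∫ x, i x τ = 1)
    -- W₂² is the squared 2-Wasserstein distance: the infimum over couplings
    (W2sq : Measure (EuclideanSpace ℝ (Fin n)) → Measure (EuclideanSpace ℝ (Fin n)) → ℝ)
    (hW2sq : ∀ μ ν, W2sq μ ν = sInf {r : ℝ |
      ∃ π : Measure (EuclideanSpace ℝ (Fin n) × EuclideanSpace ℝ (Fin n)),
        IsProbabilityMeasure π ∧ π.map Prod.fst = μ ∧ π.map Prod.snd = ν ∧
        r = ∫ p, ‖p.1 - p.2‖ ^ 2 ∂π}) :
    AntitoneOn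
      (fun s =>
        W2sq
          (volume.withDensity (fun x => ENNReal.ofReal (u₁ x (τbar₁ * Real.exp s))))
          (volume.withDensity (fun x => ENNReal.ofReal (u₂ x (τbar₂ * Real.exp s))))
        - 2 * n * (Real.sqrt (τbar₂ * Real.exp s) - Real.sqrt (τbar₁ * Real.exp s)) ^ 2)
      {s : ℝ | τbar₁ * Real.exp s ∈ I ∧ τbar₂ * Real.exp s ∈ I} := by
  obtain ⟨a, b, rfl⟩ := hIoo
  have hu : ∀ i ∈ ({u₁, u₂} : Set (EuclideanSpace ℝ (Fin n) → ℝ → ℝ)),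
      IsHeatDensity i (Ioo a b) := fun i hi =>
    ⟨hsmooth i hi, fun x τ hτ => (hpos i hi x τ hτ).le, hheat i hi, hprob i hi⟩
  have hmem : ∀ i ∈ ({u₁, u₂} : Set (EuclideanSpace ℝ (Fin n) → ℝ → ℝ)), ∀ τ ∈ Ioo a b,
      MemLp id 2 (volume.withDensity fun x => ENNReal.ofReal (i x τ)) := by
    intro i hi τ hτ
    obtain ⟨φ, hφ⟩ := hschwartz i hi τ hτ
    simpa only [hφ] using φ.memLp_two_id_withDensity
  have hm₁ : u₁ ∈ ({u₁, u₂} : Set (EuclideanSpace ℝ (Fin n) → ℝ → ℝ)) := mem_insert _ _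
  have hm₂ : u₂ ∈ ({u₁, u₂} : Set (EuclideanSpace ℝ (Fin n) → ℝ → ℝ)) := mem_insert_of_mem _ rfl
  have hτ₂ : 0 < τbar₂ := hτ₁.trans hτ₁₂
  rintro s ⟨hs₁, hs₂⟩ t ⟨ht₁, ht₂⟩ hst
  have hexp : Real.exp s ≤ Real.exp t := Real.exp_le_exp.2 hst
  have hle₁ : τbar₁ * Real.exp s ≤ τbar₁ * Real.exp t := by gcongr
  have hle₂ : τbar₂ * Real.exp s ≤ τbar₂ * Real.exp t := by gcongr
  have hcost : n * (√(2 * (τbar₁ * Real.exp t - τbar₁ * Real.exp s)) -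
        √(2 * (τbar₂ * Real.exp t - τbar₂ * Real.exp s))) ^ 2 =
      2 * n * (√(τbar₂ * Real.exp t) - √(τbar₁ * Real.exp t)) ^ 2 -
        2 * n * (√(τbar₂ * Real.exp s) - √(τbar₁ * Real.exp s)) ^ 2 := by
    have hfactor (τ : ℝ) : 2 * (τ * Real.exp t - τ * Real.exp s) =
        2 * (Real.exp t - Real.exp s) * τ := by ring
    rw [hfactor, hfactor, Real.sqrt_mul (by linarith), Real.sqrt_mul (x := 2 * _) (by linarith),
      Real.sqrt_mul hτ₁.le, Real.sqrt_mul hτ₁.le, Real.sqrt_mul hτ₂.le, Real.sqrt_mul hτ₂.le,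
      ← mul_sub, ← sub_mul, ← sub_mul, mul_pow, mul_pow, mul_pow, Real.sq_sqrt (by linarith),
      Real.sq_sqrt (Real.exp_pos t).le, Real.sq_sqrt (Real.exp_pos s).le]
    ring
  suffices h : W2sq
        (volume.withDensity fun x => ENNReal.ofReal (u₁ x (τbar₁ * Real.exp t)))
        (volume.withDensity fun x => ENNReal.ofReal (u₂ x (τbar₂ * Real.exp t))) -
      n * (√(2 * (τbar₁ * Real.exp t - τbar₁ * Real.exp s)) -
        √(2 * (τbar₂ * Real.exp t - τbar₂ * Real.exp s))) ^ 2 ≤ W2sq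
        (volume.withDensity fun x => ENNReal.ofReal (u₁ x (τbar₁ * Real.exp s)))
        (volume.withDensity fun x => ENNReal.ofReal (u₂ x (τbar₂ * Real.exp s))) by
    show _ - _ ≤ _ - _
    linarith
  rw [hW2sq, hW2sq]
  have := (hu u₁ hm₁).isProbabilityMeasure hs₁
  have := (hu u₂ hm₂).isProbabilityMeasure hs₂
  refine le_csInf ⟨_, (volume.withDensity fun x => ENNReal.ofReal (u₁ x (τbar₁ * Real.exp s))).prod
    (volume.withDensity fun x => ENNReal.ofReal (u₂ x (τbar₂ * Real.exp s))),
    inferInstance, by simp, by simp, rfl⟩ ?_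
  rintro r ⟨π, hπ, hπ₁, hπ₂, rfl⟩
  obtain ⟨π', hπ', hπ'₁, hπ'₂, hint⟩ := exists_coupling_add_stdGaussian (π := π)
    (hπ₁ ▸ hmem u₁ hm₁ _ hs₁) (hπ₂ ▸ hmem u₂ hm₂ _ hs₂)
    √(2 * (τbar₁ * Real.exp t - τbar₁ * Real.exp s))
    √(2 * (τbar₂ * Real.exp t - τbar₂ * Real.exp s))
  rw [hπ₁, ← (hu u₁ hm₁).withDensity_eq_map_add isOpen_Ioo hle₁
    (ordConnected_Ioo.out hs₁ ht₁)] at hπ'₁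
  rw [hπ₂, ← (hu u₂ hm₂).withDensity_eq_map_add isOpen_Ioo hle₂
    (ordConnected_Ioo.out hs₂ ht₂)] at hπ'₂
  rw [sub_le_iff_le_add, ← hint]
  refine csInf_le ⟨0, ?_⟩ ⟨π', hπ', hπ'₁, hπ'₂, rfl⟩
  rintro _ ⟨ρ, -, -, -, rfl⟩
  positivity
end

section
/- Let n ≥ 1, let I ⊂ (0,∞) be an open interval, and let u : ℝⁿ × I → (0,∞) be a smooth positive function that is ℤⁿ-periodic in the space variable (u(x+k,τ) = u(x,τ) for all k ∈ ℤⁿ), satisfies ∂u/∂τ = Δu on ℝⁿ × I, and satisfies ∫_{[0,1]ⁿ} u(x,τ) dx = 1 for every τ ∈ I. Define f : ℝⁿ × I → ℝ by u = (4πτ)^(-n/2)·e^(-f), i.e. f(x,τ) := -log u(x,τ) - (n/2)·log(4πτ), and define W(τ) := ∫_{[0,1]ⁿ} (τ·‖∇f(x,τ)‖² + f(x,τ) - n)·u(x,τ) dx. Then W is nonincreasing on I. -/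
open Set MeasureTheory

/-- The `i`-th partial derivative of a function on `ι → ℝ`. -/
noncomputable def partialDeriv {ι : Type*} [Fintype ι] [DecidableEq ι] (i : ι)
    (h : (ι → ℝ) → ℝ) (p : ι → ℝ) : ℝ :=
  fderiv ℝ h p (Pi.single i 1)

lemma differentiableAt_of_contDiffOn {E : Type*} [NormedAddCommGroup E] [NormedSpace ℝ E]
    {S : Set E} {a : E → ℝ} {p : E} (hS : IsOpen S) (ha : ContDiffOn ℝ (⊤ : ℕ∞) a S)
    (hp : p ∈ S) : DifferentiableAt ℝ a p :=
  (ha.contDiffAt (hS.mem_nhds hp)).differentiableAt (by simp)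

section PartialDeriv

variable {ι : Type*} [Fintype ι] [DecidableEq ι] {S : Set (ι → ℝ)} {a b : (ι → ℝ) → ℝ}
  {p : ι → ℝ}

lemma partialDeriv_contDiffOn (hS : IsOpen S) (ha : ContDiffOn ℝ (⊤ : ℕ∞) a S) (i : ι) :
    ContDiffOn ℝ (⊤ : ℕ∞) (partialDeriv i a) S :=
  (ha.fderiv_of_isOpen hS (by simp)).clm_apply contDiffOn_const

lemma partialDeriv_congr (hS : IsOpen S) (hab : EqOn a b S) (i : ι) :
    EqOn (partialDeriv i a) (partialDeriv i b) S := fun p hp => by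
  unfold partialDeriv
  rw [(hab.eventuallyEq_of_mem (hS.mem_nhds hp)).fderiv_eq]

lemma partialDeriv_mul (ha : DifferentiableAt ℝ a p) (hb : DifferentiableAt ℝ b p) (i : ι) :
    partialDeriv i (fun q => a q * b q) p =
      a p * partialDeriv i b p + b p * partialDeriv i a p := by
  simp [partialDeriv, fderiv_fun_mul ha hb]

lemma partialDeriv_const_mul (c : ℝ) (ha : DifferentiableAt ℝ a p) (i : ι) :
    partialDeriv i (fun q => c * a q) p = c * partialDeriv i a p := by
  simp [partialDeriv, fderiv_const_mul ha]

lemma partialDeriv_add (ha : DifferentiableAt ℝ a p) (hb : DifferentiableAt ℝ b p) (i : ι) :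
    partialDeriv i (fun q => a q + b q) p = partialDeriv i a p + partialDeriv i b p := by
  simp [partialDeriv, fderiv_fun_add ha hb]

lemma partialDeriv_sub (ha : DifferentiableAt ℝ a p) (hb : DifferentiableAt ℝ b p) (i : ι) :
    partialDeriv i (fun q => a q - b q) p = partialDeriv i a p - partialDeriv i b p := by
  simp [partialDeriv, fderiv_fun_sub ha hb]

lemma partialDeriv_sum {κ : Type*} {s : Finset κ} {A : κ → (ι → ℝ) → ℝ}
    (hA : ∀ k ∈ s, DifferentiableAt ℝ (A k) p) (i : ι) :
    partialDeriv i (fun q => ∑ k ∈ s, A k q) p = ∑ k ∈ s, partialDeriv i (A k) p := by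
  simp [partialDeriv, fderiv_fun_sum hA]

lemma partialDeriv_comm (hS : IsOpen S) (ha : ContDiffOn ℝ (⊤ : ℕ∞) a S) (hp : p ∈ S) (i j : ι) :
    partialDeriv i (partialDeriv j a) p = partialDeriv j (partialDeriv i a) p := by
  have hd : DifferentiableAt ℝ (fderiv ℝ a) p :=
    ((ha.fderiv_of_isOpen (m := (⊤ : ℕ∞)) hS (by simp)).contDiffAt
      (hS.mem_nhds hp)).differentiableAt (by simp)
  have key (k l : ι) : partialDeriv k (partialDeriv l a) p =
      fderiv ℝ (fderiv ℝ a) p (Pi.single k 1) (Pi.single l 1) := by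
    change fderiv ℝ (fun q => fderiv ℝ a q (Pi.single l 1)) p (Pi.single k 1) = _
    rw [fderiv_clm_apply hd (differentiableAt_const _)]
    simp
  rw [key, key]
  exact ((ha.contDiffAt (hS.mem_nhds hp)).isSymmSndFDerivAt (by
    simpa using WithTop.coe_le_coe.2 (le_top : (2 : ℕ∞) ≤ ⊤))).eq _ _

lemma partialDeriv_comp_eval (i k : ι) {φ : ℝ → ℝ} {φ' : ℝ} (hφ : HasDerivAt φ φ' (p k)) :
    partialDeriv i (fun q => φ (q k)) p = φ' * (Pi.single i 1 : ι → ℝ) k := by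
  have := (hφ.comp_hasFDerivAt p
    (ContinuousLinearMap.proj (R := ℝ) (φ := fun _ : ι => ℝ) k).hasFDerivAt).fderiv
  simp only [Function.comp_def, ContinuousLinearMap.proj_apply] at this
  simp [partialDeriv, this]

lemma partialDeriv_periodic (hS : IsOpen S) {v : ι → ℝ}
    (ha : ∀ q ∈ S, a (q + v) = a q) (i : ι) :
    ∀ q ∈ S, partialDeriv i a (q + v) = partialDeriv i a q := fun q hq => by
  have h : (fun x => a (x + v)) =ᶠ[nhds q] a := by
    filter_upwards [hS.mem_nhds hq] with x hx using ha x hx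
  unfold partialDeriv
  rw [← h.fderiv_eq, fderiv_comp_add_right]

end PartialDeriv

section Slices

variable {n : ℕ} {h : (Fin (n + 1) → ℝ) → ℝ} {x : Fin n → ℝ} {t : ℝ}

lemma deriv_cons (hd : DifferentiableAt ℝ h (Fin.cons t x : Fin (n + 1) → ℝ)) :
    deriv (fun s => h (Fin.cons s x : Fin (n + 1) → ℝ)) t =
      partialDeriv 0 h (Fin.cons t x : Fin (n + 1) → ℝ) := by
  have hA : HasDerivAt (fun s : ℝ => (Fin.cons s x : Fin (n + 1) → ℝ)) (Pi.single 0 1) t := by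
    rw [hasDerivAt_pi]
    refine Fin.cases ?_ fun j => ?_
    · simpa using hasDerivAt_id' t
    · simpa using hasDerivAt_const t (x j)
  exact (hd.hasFDerivAt.comp_hasDerivAt t hA).deriv

lemma fderiv_cons (hd : DifferentiableAt ℝ h (Fin.cons t x : Fin (n + 1) → ℝ)) (j : Fin n) :
    fderiv ℝ (fun y => h (Fin.cons t y : Fin (n + 1) → ℝ)) x (Pi.single j 1) =
      partialDeriv j.succ h (Fin.cons t x : Fin (n + 1) → ℝ) := by
  let L : (Fin n → ℝ) →L[ℝ] (Fin (n + 1) → ℝ) :=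
    ContinuousLinearMap.pi (Fin.cases 0 fun j => ContinuousLinearMap.proj j)
  have hA : HasFDerivAt (fun y : Fin n → ℝ => (Fin.cons t y : Fin (n + 1) → ℝ)) L x := by
    refine hasFDerivAt_pi.2 (Fin.cases ?_ fun j => ?_)
    · simpa using hasFDerivAt_const t x
    · simpa using hasFDerivAt_apply j x
  have hL : L (Pi.single j 1) = Pi.single j.succ 1 := by
    ext i
    refine Fin.cases ?_ (fun k => ?_) i
    · simp [L]
    · simp [L, Pi.single_apply]
  have := (hd.hasFDerivAt.comp x hA).fderiv
  simp only [Function.comp_def] at this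
  simp [partialDeriv, this, hL]

end Slices

/-- The heat operator `∂ₜ - Δ`, where coordinate `0` is time. -/
noncomputable def heatOp {n : ℕ} (h : (Fin (n + 1) → ℝ) → ℝ) (p : Fin (n + 1) → ℝ) : ℝ :=
  partialDeriv 0 h p - ∑ k : Fin n, partialDeriv k.succ (partialDeriv k.succ h) p

section HeatOp

variable {n : ℕ} {S : Set (Fin (n + 1) → ℝ)} {a b : (Fin (n + 1) → ℝ) → ℝ}
  {p : Fin (n + 1) → ℝ}

lemma heatOp_sub (hS : IsOpen S) (ha : ContDiffOn ℝ (⊤ : ℕ∞) a S)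
    (hb : ContDiffOn ℝ (⊤ : ℕ∞) b S) (hp : p ∈ S) :
    heatOp (fun q => a q - b q) p = heatOp a p - heatOp b p := by
  have hd {c} (hc : ContDiffOn ℝ (⊤ : ℕ∞) c S) {q} (hq : q ∈ S) :=
    differentiableAt_of_contDiffOn hS hc hq
  have h2 (i) : partialDeriv i (partialDeriv i fun q => a q - b q) p =
      partialDeriv i (partialDeriv i a) p - partialDeriv i (partialDeriv i b) p := by
    rw [partialDeriv_congr hS (fun q hq => partialDeriv_sub (hd ha hq) (hd hb hq) i) i hp,
      partialDeriv_sub (hd (partialDeriv_contDiffOn hS ha i) hp)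
        (hd (partialDeriv_contDiffOn hS hb i) hp)]
  simp only [heatOp, h2, partialDeriv_sub (hd ha hp) (hd hb hp), Finset.sum_sub_distrib]
  ring

lemma heatOp_sum {κ : Type*} {s : Finset κ} {A : κ → (Fin (n + 1) → ℝ) → ℝ} (hS : IsOpen S)
    (hA : ∀ k ∈ s, ContDiffOn ℝ (⊤ : ℕ∞) (A k) S) (hp : p ∈ S) :
    heatOp (fun q => ∑ k ∈ s, A k q) p = ∑ k ∈ s, heatOp (A k) p := by
  have hd {c} (hc : ContDiffOn ℝ (⊤ : ℕ∞) c S) {q} (hq : q ∈ S) :=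
    differentiableAt_of_contDiffOn hS hc hq
  have h2 (i) : partialDeriv i (partialDeriv i fun q => ∑ k ∈ s, A k q) p =
      ∑ k ∈ s, partialDeriv i (partialDeriv i (A k)) p := by
    rw [partialDeriv_congr hS (fun q hq => partialDeriv_sum (fun k hk => hd (hA k hk) hq) i) i hp,
      partialDeriv_sum fun k hk => hd (partialDeriv_contDiffOn hS (hA k hk) i) hp]
  simp only [heatOp, h2, partialDeriv_sum fun k hk => hd (hA k hk) hp, Finset.sum_sub_distrib]
  rw [Finset.sum_comm]

lemma heatOp_mul (hS : IsOpen S) (ha : ContDiffOn ℝ (⊤ : ℕ∞) a S)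
    (hb : ContDiffOn ℝ (⊤ : ℕ∞) b S) (hp : p ∈ S) :
    heatOp (fun q => a q * b q) p = a p * heatOp b p + b p * heatOp a p -
      2 * ∑ k : Fin n, partialDeriv k.succ a p * partialDeriv k.succ b p := by
  have hd {c} (hc : ContDiffOn ℝ (⊤ : ℕ∞) c S) {q} (hq : q ∈ S) :=
    differentiableAt_of_contDiffOn hS hc hq
  have h2 (i) : partialDeriv i (partialDeriv i fun q => a q * b q) p =
      a p * partialDeriv i (partialDeriv i b) p + b p * partialDeriv i (partialDeriv i a) p +
        2 * (partialDeriv i a p * partialDeriv i b p) := by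
    have ha' := partialDeriv_contDiffOn hS ha i
    have hb' := partialDeriv_contDiffOn hS hb i
    rw [partialDeriv_congr hS (fun q hq => partialDeriv_mul (hd ha hq) (hd hb hq) i) i hp,
      partialDeriv_add (hd (ha.mul hb') hp) (hd (hb.mul ha') hp),
      partialDeriv_mul (hd ha hp) (hd hb' hp), partialDeriv_mul (hd hb hp) (hd ha' hp)]
    ring
  simp only [heatOp, h2, partialDeriv_mul (hd ha hp) (hd hb hp), Finset.sum_add_distrib,
    ← Finset.mul_sum]
  ring

/-- The heat operator commutes with partial derivatives. -/
lemma heatOp_partialDeriv (hS : IsOpen S) (ha : ContDiffOn ℝ (⊤ : ℕ∞) a S) (hp : p ∈ S)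
    (i : Fin (n + 1)) : heatOp (partialDeriv i a) p = partialDeriv i (heatOp a) p := by
  have hd {c} (hc : ContDiffOn ℝ (⊤ : ℕ∞) c S) : DifferentiableAt ℝ c p :=
    differentiableAt_of_contDiffOn hS hc hp
  have h1 (j) := partialDeriv_contDiffOn hS ha j
  have h2 (j k) := partialDeriv_contDiffOn hS (h1 j) k
  have h3 (j) : partialDeriv j (partialDeriv j (partialDeriv i a)) p =
      partialDeriv i (partialDeriv j (partialDeriv j a)) p := by
    rw [partialDeriv_congr hS (fun q hq => partialDeriv_comm hS ha hq j i) j hp,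
      partialDeriv_comm hS (h1 j) hp]
  change _ = partialDeriv i (fun q => partialDeriv 0 a q -
    ∑ k : Fin n, partialDeriv k.succ (partialDeriv k.succ a) q) p
  rw [partialDeriv_sub (hd (h1 0)) (hd (ContDiffOn.sum fun k _ => h2 k.succ k.succ)),
    partialDeriv_sum fun k _ => hd (h2 _ _)]
  simp only [heatOp, h3, partialDeriv_comm hS ha hp 0 i]

lemma heatOp_comp_time {φ φ' : ℝ → ℝ} (hS : IsOpen S)
    (hφ : ∀ q ∈ S, HasDerivAt φ (φ' (q 0)) (q 0)) (hp : p ∈ S) :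
    heatOp (fun q => φ (q 0)) p = φ' (p 0) := by
  have h2 (k : Fin n) : partialDeriv k.succ (partialDeriv k.succ fun q => φ (q 0)) p = 0 := by
    rw [partialDeriv_congr hS (b := fun _ => 0)
      (fun q hq => by simp [partialDeriv_comp_eval k.succ 0 (hφ q hq)]) k.succ hp]
    simp [partialDeriv]
  simp [heatOp, h2, partialDeriv_comp_eval 0 0 (hφ p hp)]

lemma partialDeriv_exp {U G : (Fin (n + 1) → ℝ) → ℝ} (hS : IsOpen S)
    (hG : ContDiffOn ℝ (⊤ : ℕ∞) G S) (hU : EqOn U (fun q => Real.exp (G q)) S)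
    (i : Fin (n + 1)) : EqOn (partialDeriv i U) (fun q => U q * partialDeriv i G q) S :=
  fun q hq => by
    rw [partialDeriv_congr hS hU i hq]
    simp [partialDeriv, hU hq, fderiv_exp (differentiableAt_of_contDiffOn hS hG hq)]

lemma partialDeriv_partialDeriv_exp {U G : (Fin (n + 1) → ℝ) → ℝ} (hS : IsOpen S)
    (hG : ContDiffOn ℝ (⊤ : ℕ∞) G S) (hU : EqOn U (fun q => Real.exp (G q)) S)
    (hp : p ∈ S) (i : Fin (n + 1)) : partialDeriv i (partialDeriv i U) p =
      U p * (partialDeriv i (partialDeriv i G) p + partialDeriv i G p * partialDeriv i G p) := by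
  rw [partialDeriv_congr hS (partialDeriv_exp hS hG hU i) i hp,
    partialDeriv_mul (differentiableAt_of_contDiffOn hS (hG.exp.congr hU) hp)
      (differentiableAt_of_contDiffOn hS (partialDeriv_contDiffOn hS hG i) hp),
    partialDeriv_exp hS hG hU i hp]
  ring

/-- The logarithm of a positive solution of the heat equation satisfies `(∂ₜ - Δ) G = |∇G|²`. -/
lemma heatOp_log {U G : (Fin (n + 1) → ℝ) → ℝ} (hS : IsOpen S)
    (hG : ContDiffOn ℝ (⊤ : ℕ∞) G S) (hU : EqOn U (fun q => Real.exp (G q)) S)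
    (hheat : ∀ q ∈ S, heatOp U q = 0) (hp : p ∈ S) :
    heatOp G p = ∑ k : Fin n, partialDeriv k.succ G p * partialDeriv k.succ G p := by
  have hne : U p ≠ 0 := by rw [hU hp]; positivity
  have h := hheat p hp
  simp only [heatOp, partialDeriv_partialDeriv_exp hS hG hU hp, partialDeriv_exp hS hG hU 0 hp,
    ← Finset.mul_sum, ← mul_sub] at h
  have := (mul_eq_zero.1 h).resolve_left hne
  rw [Finset.sum_add_distrib] at this
  simp only [heatOp]
  linarith

/-- The Bochner formula for the logarithm of a positive solution of the heat equation. -/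
lemma heatOp_sq_grad_log {U G : (Fin (n + 1) → ℝ) → ℝ} (hS : IsOpen S)
    (hG : ContDiffOn ℝ (⊤ : ℕ∞) G S) (hU : EqOn U (fun q => Real.exp (G q)) S)
    (hheat : ∀ q ∈ S, heatOp U q = 0) (hp : p ∈ S) :
    heatOp (fun q => ∑ j : Fin n, partialDeriv j.succ G q * partialDeriv j.succ G q) p =
      2 * ∑ k : Fin n, partialDeriv k.succ G p *
        partialDeriv k.succ
          (fun q => ∑ j : Fin n, partialDeriv j.succ G q * partialDeriv j.succ G q) p -
      2 * ∑ j : Fin n, ∑ k : Fin n, partialDeriv k.succ (partialDeriv j.succ G) p ^ 2 := by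
  have h1 (j) := partialDeriv_contDiffOn hS hG j
  rw [heatOp_sum hS (fun j _ => (h1 j.succ).mul (h1 j.succ)) hp, Finset.mul_sum, Finset.mul_sum,
    ← Finset.sum_sub_distrib]
  refine Finset.sum_congr rfl fun j _ => ?_
  rw [heatOp_mul hS (h1 j.succ) (h1 j.succ) hp, heatOp_partialDeriv hS hG hp,
    partialDeriv_congr hS (fun q hq => heatOp_log hS hG hU hheat hq) j.succ hp]
  simp only [sq]
  ring

/-- The evolution of Perelman's entropy density `(τ |∇G|² - G - n/2 log (4πτ) - n) U`. -/
lemma heatOp_entropy {U G : (Fin (n + 1) → ℝ) → ℝ} (hS : IsOpen S)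
    (hpos : ∀ q ∈ S, 0 < q 0)
    (hG : ContDiffOn ℝ (⊤ : ℕ∞) G S) (hU : EqOn U (fun q => Real.exp (G q)) S)
    (hheat : ∀ q ∈ S, heatOp U q = 0) (hp : p ∈ S) :
    heatOp (fun q =>
        (q 0 * (∑ j : Fin n, partialDeriv j.succ G q * partialDeriv j.succ G q) - G q -
          ((n : ℝ) / 2 * Real.log (4 * Real.pi * q 0) + n)) * U q) p -
      2 * ∑ k : Fin n, partialDeriv k.succ (partialDeriv k.succ U) p =
    -2 * p 0 * U p * ∑ j : Fin n, ∑ k : Fin n,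
      (partialDeriv k.succ (partialDeriv j.succ G) p + if k = j then 1 / (2 * p 0) else 0) ^ 2 := by
  have hd {c} (hc : ContDiffOn ℝ (⊤ : ℕ∞) c S) : DifferentiableAt ℝ c p :=
    differentiableAt_of_contDiffOn hS hc hp
  have hp0 : p 0 ≠ 0 := (hpos p hp).ne'
  have h1 (j) := partialDeriv_contDiffOn hS hG j
  have hT : ContDiffOn ℝ (⊤ : ℕ∞) (fun q : Fin (n + 1) → ℝ => q 0) S :=
    (contDiff_apply ℝ ℝ (0 : Fin (n + 1))).contDiffOn
  have hC : ContDiffOn ℝ (⊤ : ℕ∞) (fun q : Fin (n + 1) → ℝ =>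
      (n : ℝ) / 2 * Real.log (4 * Real.pi * q 0) + n) S :=
    (contDiffOn_const.mul ((contDiffOn_const.mul hT).log fun q hq => by
      have := hpos q hq; positivity)).add contDiffOn_const
  have hCd : ∀ q ∈ S, HasDerivAt (fun t : ℝ => (n : ℝ) / 2 * Real.log (4 * Real.pi * t) + n)
      (n / (2 * q 0)) (q 0) := fun q hq => by
    have := hpos q hq
    have hlog : HasDerivAt (fun t : ℝ => Real.log (4 * Real.pi * t))
        (4 * Real.pi * 1 / (4 * Real.pi * q 0)) (q 0) :=
      ((hasDerivAt_id' (q 0)).const_mul (4 * Real.pi)).log (by positivity)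
    exact ((hlog.const_mul ((n : ℝ) / 2)).add_const (n : ℝ)).congr_deriv (by field_simp)
  set Q : (Fin (n + 1) → ℝ) → ℝ :=
    fun q => ∑ j : Fin n, partialDeriv j.succ G q * partialDeriv j.succ G q with hQdef
  have hQ : ContDiffOn ℝ (⊤ : ℕ∞) Q S :=
    ContDiffOn.sum fun j _ => (h1 j.succ).mul (h1 j.succ)
  have hTQ := hT.mul hQ
  have heatOp_time : heatOp (fun q => q 0) p = 1 :=
    heatOp_comp_time (φ := fun t => t) (φ' := fun _ => 1) hS (fun q _ => hasDerivAt_id' _) hp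
  have partial_time (i : Fin n) : partialDeriv i.succ (fun q : Fin (n + 1) → ℝ => q 0) p = 0 := by
    simpa using partialDeriv_comp_eval i.succ 0 (hasDerivAt_id' (p 0))
  have heatOp_normalization := heatOp_comp_time (φ' := fun t => n / (2 * t)) hS hCd hp
  have partial_normalization (i : Fin n) : partialDeriv i.succ
      (fun q : Fin (n + 1) → ℝ => (n : ℝ) / 2 * Real.log (4 * Real.pi * q 0) + n) p = 0 := by
    simpa using partialDeriv_comp_eval i.succ 0 (hCd p hp)
  have partial_density (k : Fin n) : partialDeriv k.succ (fun q => q 0 * Q q - G q -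
      ((n : ℝ) / 2 * Real.log (4 * Real.pi * q 0) + n)) p =
      p 0 * partialDeriv k.succ Q p - partialDeriv k.succ G p := by
    rw [partialDeriv_sub (hd (hTQ.sub hG)) (hd hC), partialDeriv_sub (hd hTQ) (hd hG),
      partialDeriv_mul (hd hT) (hd hQ), partial_normalization, partial_time]
    simp
  have sum_sq_expand : ∑ j : Fin n, ∑ k : Fin n, (partialDeriv k.succ (partialDeriv j.succ G) p +
      if k = j then 1 / (2 * p 0) else 0) ^ 2 =
      ∑ j : Fin n, ∑ k : Fin n, partialDeriv k.succ (partialDeriv j.succ G) p ^ 2 +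
      1 / p 0 * ∑ j : Fin n, partialDeriv j.succ (partialDeriv j.succ G) p +
      n / (4 * p 0 ^ 2) := by
    have (j k : Fin n) : (partialDeriv k.succ (partialDeriv j.succ G) p +
      if k = j then 1 / (2 * p 0) else 0) ^ 2 =
      partialDeriv k.succ (partialDeriv j.succ G) p ^ 2 + if k = j then
        1 / p 0 * partialDeriv j.succ (partialDeriv j.succ G) p + 1 / (4 * p 0 ^ 2) else 0 := by
      split_ifs with hkj
      · subst hkj; field_simp; ring
      · ring
    simp only [this, Finset.sum_add_distrib, Finset.sum_ite_eq', Finset.mem_univ, if_true,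
      ← Finset.mul_sum]
    simp
    ring
  rw [heatOp_mul hS ((hTQ.sub hG).sub hC) (hG.exp.congr hU) hp, hheat p hp,
    heatOp_sub hS (hTQ.sub hG) hC hp, heatOp_sub hS hTQ hG hp, heatOp_mul hS hT hQ hp,
    heatOp_time, heatOp_log hS hG hU hheat hp,
    heatOp_sq_grad_log hS hG hU hheat hp, sum_sq_expand]
  simp only [partial_time, heatOp_normalization, partial_density, partialDeriv_exp hS hG hU _ hp,
    partialDeriv_partialDeriv_exp hS hG hU hp]
  have cross_term : ∑ k : Fin n, (p 0 * partialDeriv k.succ Q p - partialDeriv k.succ G p) *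
      (U p * partialDeriv k.succ G p) = U p * (p 0 * ∑ k : Fin n, partialDeriv k.succ G p *
        partialDeriv k.succ Q p - Q p) := by
    simp only [hQdef, Finset.mul_sum, ← Finset.sum_sub_distrib]
    exact Finset.sum_congr rfl fun k _ => by ring
  simp only [cross_term, ← Finset.mul_sum, Finset.sum_add_distrib]
  have sq_grad_eq : ∑ k : Fin n, partialDeriv k.succ G p * partialDeriv k.succ G p = Q p := rfl
  simp only [sq_grad_eq, ← hQdef]
  field_simp
  ring

end HeatOp

/-- A space-time vector field that is smooth and periodic on a neighbourhood of the slab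
`[s, t] × [0, 1]ⁿ` and has nonpositive divergence loses flux through the time slices. -/
lemma integral_time_slice_le_of_divergence_nonpos {n : ℕ} {S : Set (Fin (n + 1) → ℝ)}
    (hS : IsOpen S) {s t : ℝ} (hst : s ≤ t) (hslab : ∀ q : Fin (n + 1) → ℝ, q 0 ∈ Icc s t → q ∈ S)
    {V : Fin (n + 1) → (Fin (n + 1) → ℝ) → ℝ} (hV : ∀ i, ContDiffOn ℝ (⊤ : ℕ∞) (V i) S)
    (hper : ∀ k : Fin n, ∀ q ∈ S, V k.succ (q + Pi.single k.succ 1) = V k.succ q)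
    (hdiv : ∀ q ∈ S, ∑ i, partialDeriv i (V i) q ≤ 0) :
    ∫ x in Icc (0 : Fin n → ℝ) 1, V 0 (Fin.cons t x : Fin (n + 1) → ℝ) ≤
      ∫ x in Icc (0 : Fin n → ℝ) 1, V 0 (Fin.cons s x : Fin (n + 1) → ℝ) := by
  set a : Fin (n + 1) → ℝ := Fin.cons s 0
  set b : Fin (n + 1) → ℝ := Fin.cons t 1
  have hab : a ≤ b := by
    refine Fin.cases ?_ fun j => ?_
    · simpa [a, b] using hst
    · simp [a, b]
  have hsub : Icc a b ⊆ S := fun q hq => hslab q ⟨hq.1 0, hq.2 0⟩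
  have hcont : ContinuousOn (fun q => ∑ i, partialDeriv i (V i) q) S :=
    continuousOn_finsetSum _ fun i _ => (partialDeriv_contDiffOn hS (hV i) i).continuousOn
  have key := integral_divergence_of_hasFDerivAt_off_countable' a b hab V
    (fun i => fderiv ℝ (V i)) ∅ countable_empty
    (fun i => (hV i).continuousOn.mono hsub)
    (fun x hx i => (differentiableAt_of_contDiffOn hS (hV i)
      (hsub ⟨fun j => (hx.1 j trivial).1.le, fun j => (hx.1 j trivial).2.le⟩)).hasFDerivAt)
    ((hcont.mono hsub).integrableOn_compact isCompact_Icc)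
  have hle : ∫ x in Icc a b, ∑ i, fderiv ℝ (V i) x (Pi.single i 1) ≤ 0 :=
    setIntegral_nonpos measurableSet_Icc fun q hq => hdiv q (hsub hq)
  have hface (k : Fin n) : ∫ x in Icc (a ∘ k.succ.succAbove) (b ∘ k.succ.succAbove),
        V k.succ (k.succ.insertNth (b k.succ) x) =
      ∫ x in Icc (a ∘ k.succ.succAbove) (b ∘ k.succ.succAbove),
        V k.succ (k.succ.insertNth (a k.succ) x) := by
    refine setIntegral_congr_fun measurableSet_Icc fun x hx => ?_
    have hmem : (k.succ.insertNth (a k.succ) x : Fin (n + 1) → ℝ) ∈ S := hsub <| by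
      rw [Fin.insertNth_mem_Icc]
      exact ⟨⟨le_rfl, hab _⟩, hx⟩
    rw [← hper k _ hmem]
    congr 1
    ext j
    refine Fin.succAboveCases k.succ ?_ (fun i => ?_) j
    · simp [a, b]
    · simp
  rw [key, Fin.sum_univ_succ] at hle
  simp only [hface, sub_self, Finset.sum_const_zero, add_zero] at hle
  simpa [a, b, Fin.insertNth_zero, Function.comp_def, Pi.zero_def, Pi.one_def] using hle

theorem W_entropy_monotone_flat_torus
    (n : ℕ) (hn : 1 ≤ n)
    (I : Set ℝ) (hIoo : ∃ a b : ℝ, I = Ioo a b) (hIpos : I ⊆ Ioi 0)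
    (u : (Fin n → ℝ) → ℝ → ℝ)
    -- u is smooth and positive on ℝⁿ × I
    (husmooth : ContDiffOn ℝ (⊤ : ℕ∞) (fun p : (Fin n → ℝ) × ℝ => u p.1 p.2) (univ ×ˢ I))
    (hupos : ∀ x, ∀ τ ∈ I, 0 < u x τ)
    -- u is ℤⁿ-periodic in the space variable
    (hper : ∀ (k : Fin n → ℤ) (x : Fin n → ℝ), ∀ τ ∈ I,
      u (x + fun i => (k i : ℝ)) τ = u x τ)
    -- u solves the heat equation ∂u/∂τ = Δu on ℝⁿ × I
    (hheat : ∀ x, ∀ τ ∈ I,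
      deriv (fun t => u x t) τ =
        ∑ j : Fin n, fderiv ℝ
          (fun x' => fderiv ℝ (fun x'' => u x'' τ) x' (Pi.single j 1)) x
          (Pi.single j 1))
    -- u(·,τ) has unit mass over the fundamental domain [0,1]ⁿ
    (hmass : ∀ τ ∈ I, ∫ x in Set.pi univ (fun _ : Fin n => Icc (0 : ℝ) 1), u x τ = 1)
    -- f is defined by u = (4πτ)^(-n/2)·e^(-f)
    (f : (Fin n → ℝ) → ℝ → ℝ)
    (hf : ∀ x τ, f x τ = -Real.log (u x τ) - ((n : ℝ) / 2) * Real.log (4 * Real.pi * τ))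
    -- the W-entropy, with ‖∇f‖² the flat gradient norm squared
    (W : ℝ → ℝ)
    (hW : ∀ τ, W τ = ∫ x in Set.pi univ (fun _ : Fin n => Icc (0 : ℝ) 1),
      (τ * ∑ j : Fin n, (fderiv ℝ (fun x' => f x' τ) x (Pi.single j 1)) ^ 2
        + f x τ - n) * u x τ) :
    AntitoneOn W I := by
  obtain ⟨a, b, rfl⟩ := hIoo
  set S : Set (Fin (n + 1) → ℝ) := {q | q 0 ∈ Ioo a b}
  have hS : IsOpen S := isOpen_Ioo.preimage (continuous_apply 0)
  have hcons {x : Fin n → ℝ} {τ : ℝ} (hτ : τ ∈ Ioo a b) :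
      (Fin.cons τ x : Fin (n + 1) → ℝ) ∈ S := by simpa [S] using hτ
  set U : (Fin (n + 1) → ℝ) → ℝ := fun q => u (Fin.tail q) (q 0)
  set G : (Fin (n + 1) → ℝ) → ℝ := fun q => Real.log (U q)
  have hUpos : ∀ q ∈ S, 0 < U q := fun q hq => hupos _ _ hq
  have hUs : ContDiffOn ℝ (⊤ : ℕ∞) U S := by
    have hsplit : ContDiff ℝ (⊤ : ℕ∞) fun q : Fin (n + 1) → ℝ => (Fin.tail q, q 0) :=
      (contDiff_pi.2 fun j : Fin n => contDiff_apply ℝ ℝ j.succ).prodMk (contDiff_apply ℝ ℝ 0)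
    exact husmooth.comp hsplit.contDiffOn fun q hq => ⟨trivial, hq⟩
  have hGs : ContDiffOn ℝ (⊤ : ℕ∞) G S := hUs.log fun q hq => (hUpos q hq).ne'
  have hUG : EqOn U (fun q => Real.exp (G q)) S := fun q hq => (Real.exp_log (hUpos q hq)).symm
  have hslice {h} (hh : ContDiffOn ℝ (⊤ : ℕ∞) h S) {x τ} (hτ : τ ∈ Ioo a b) (j : Fin n) :=
    fderiv_cons (differentiableAt_of_contDiffOn hS hh (hcons (x := x) hτ)) j
  have hheatU : ∀ q ∈ S, heatOp U q = 0 := fun q hq => by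
    obtain ⟨τ, x, rfl⟩ : ∃ (τ : ℝ) (x : Fin n → ℝ), q = Fin.cons τ x :=
      ⟨q 0, Fin.tail q, (Fin.cons_self_tail q).symm⟩
    have hτ : τ ∈ Ioo a b := by simpa [S] using hq
    have h1 := deriv_cons (differentiableAt_of_contDiffOn hS hUs hq)
    have h2 (j : Fin n) : fderiv ℝ (fun y => fderiv ℝ (fun z => u z τ) y (Pi.single j 1)) x
        (Pi.single j 1) =
          partialDeriv j.succ (partialDeriv j.succ U) (Fin.cons τ x : Fin (n + 1) → ℝ) := by
      rw [← hslice (partialDeriv_contDiffOn hS hUs j.succ) hτ j]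
      simp_rw [← hslice hUs hτ j]
      simp [U]
    rw [heatOp, ← h1]
    simp_rw [← h2]
    rw [← hheat x τ hτ]
    simp [U]
  set w : (Fin (n + 1) → ℝ) → ℝ := fun q =>
    (q 0 * (∑ j : Fin n, partialDeriv j.succ G q * partialDeriv j.succ G q) - G q -
      ((n : ℝ) / 2 * Real.log (4 * Real.pi * q 0) + n)) * U q with hw
  have hGd (j) := partialDeriv_contDiffOn hS hGs j
  have hT : ContDiffOn ℝ (⊤ : ℕ∞) (fun q : Fin (n + 1) → ℝ => q 0) S :=
    (contDiff_apply ℝ ℝ (0 : Fin (n + 1))).contDiffOn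
  have hws : ContDiffOn ℝ (⊤ : ℕ∞) w S :=
    (((hT.mul (ContDiffOn.sum fun j _ => (hGd j.succ).mul (hGd j.succ))).sub hGs).sub
      ((contDiffOn_const.mul ((contDiffOn_const.mul hT).log fun q hq => by
        have : 0 < q 0 := hIpos hq
        positivity)).add contDiffOn_const)).mul hUs
  have hWw {τ} (hτ : τ ∈ Ioo a b) :
      W τ = ∫ x in Icc (0 : Fin n → ℝ) 1, w (Fin.cons τ x : Fin (n + 1) → ℝ) := by
    rw [hW, pi_univ_Icc]
    refine integral_congr_ae (Filter.Eventually.of_forall fun x => ?_)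
    have hfG (j : Fin n) : fderiv ℝ (fun y => f y τ) x (Pi.single j 1) =
        -partialDeriv j.succ G (Fin.cons τ x) := by
      rw [← hslice hGs hτ j]
      simp [hf, G, U, fderiv_sub_const]
    simp only [hfG, neg_sq]
    simp only [hf, hw, G, U, Fin.cons_zero, Fin.tail_cons, sq]
    ring
  have hUper (k : Fin n) : ∀ q ∈ S, U (q + Pi.single k.succ 1) = U q := fun q hq => by
    have := hper (Pi.single k 1) (Fin.tail q) _ hq
    have h0 : (q + Pi.single k.succ 1 : Fin (n + 1) → ℝ) 0 = q 0 := by simp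
    have h1 : Fin.tail (q + Pi.single k.succ 1) =
        Fin.tail q + fun i => ((Pi.single k 1 : Fin n → ℤ) i : ℝ) := by
      ext i
      simp [Fin.tail, Pi.single_apply, apply_ite]
    simp only [U, h0, h1, this]
  have hGper (k : Fin n) : ∀ q ∈ S, G (q + Pi.single k.succ 1) = G q := fun q hq => by
    simp only [G, hUper k q hq]
  have hwper (k : Fin n) : ∀ q ∈ S, w (q + Pi.single k.succ 1) = w q := fun q hq => by
    simp [hw, hUper k q hq, hGper k q hq, partialDeriv_periodic hS (hGper k) _ q hq]
  set V : Fin (n + 1) → (Fin (n + 1) → ℝ) → ℝ := Fin.cons w fun k q =>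
    -2 * partialDeriv k.succ U q - partialDeriv k.succ w q with hVdef
  have hUd (j) := partialDeriv_contDiffOn hS hUs j
  have hwd (j) := partialDeriv_contDiffOn hS hws j
  intro s hs t ht hst
  rw [hWw hs, hWw ht]
  refine integral_time_slice_le_of_divergence_nonpos (V := V) hS hst
    (fun q hq => ⟨hs.1.trans_le hq.1, hq.2.trans_lt ht.2⟩) ?_ ?_ ?_
  · exact Fin.cases hws fun k => (contDiffOn_const.mul (hUd k.succ)).sub (hwd k.succ)
  · intro k q hq
    simp only [hVdef, Fin.cons_succ, partialDeriv_periodic hS (hUper k) _ q hq,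
      partialDeriv_periodic hS (hwper k) _ q hq]
  · intro q hq
    have hq0 : 0 < q 0 := hIpos hq
    have hd {c} (hc : ContDiffOn ℝ (⊤ : ℕ∞) c S) : DifferentiableAt ℝ c q :=
      differentiableAt_of_contDiffOn hS hc hq
    have hdivV (k : Fin n) : partialDeriv k.succ (V k.succ) q =
        -2 * partialDeriv k.succ (partialDeriv k.succ U) q -
          partialDeriv k.succ (partialDeriv k.succ w) q := by
      simp only [hVdef, Fin.cons_succ]
      rw [partialDeriv_sub (hd (contDiffOn_const.mul (hUd k.succ))) (hd (hwd k.succ)),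
        partialDeriv_const_mul _ (hd (hUd k.succ))]
    have key := heatOp_entropy hS (fun q hq => hIpos hq) hGs hUG hheatU hq
    rw [← hw, heatOp] at key
    rw [Fin.sum_univ_succ]
    simp only [hdivV, Finset.sum_sub_distrib, ← Finset.mul_sum]
    have hnonneg : 0 ≤ q 0 * U q * ∑ j : Fin n, ∑ k : Fin n,
        (partialDeriv k.succ (partialDeriv j.succ G) q +
          if k = j then 1 / (2 * q 0) else 0) ^ 2 :=
      mul_nonneg (mul_nonneg hq0.le (hUpos q hq).le)
        (Finset.sum_nonneg fun j _ => Finset.sum_nonneg fun k _ => sq_nonneg _)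
    simp only [hVdef, Fin.cons_zero]
    linarith
end
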